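/- For any ξ ∈ F_q((T^{-1})) and any integer n ≥ 1, w_n^*(ξ) = w_n^@(ξ); that is, the exponent of approximation by algebraic elements of degree at most n lying in F_q((T^{-1})) equals the exponent of approximation by algebraic elements of degree at most n lying in the completion C_∞ of an algebraic closure of F_q((T^{-1})). -/

import Mathlib

open Polynomial
open scoped Classical

namespace MahlerKoksmaFq

noncomputable section

variable (Fq : Type) [Field Fq] [Fintype Fq]

/-- `K Fq` models `F_q((T⁻¹))`: Laurent series in the variable `t = T⁻¹`. -/
abbrev K := LaurentSeries Fq

/-- The element `T` (the inverse of the Laurent-series variable `t = T⁻¹`). -/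
def Tvar : K Fq := HahnSeries.single (-1 : ℤ) 1

/-- The absolute value `|ξ| = q^{-ν(ξ)}` on `F_q((T⁻¹))`. -/
def absK (ξ : K Fq) : ℝ :=
  if ξ = 0 then 0 else (Fintype.card Fq : ℝ) ^ (-(HahnSeries.order ξ))

/-- The embedding of `F_q[T]` into `F_q((T⁻¹))`, sending `T` to `Tvar`. -/
def emb : Polynomial Fq →+* K Fq :=
  Polynomial.eval₂RingHom (algebraMap Fq (K Fq)) (Tvar Fq)

/-- Evaluation of `P ∈ F_q[T][X]` at `ξ ∈ F_q((T⁻¹))`. -/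
def evalK (P : Polynomial (Polynomial Fq)) (ξ : K Fq) : K Fq :=
  P.eval₂ (emb Fq) ξ

/-- Height of a polynomial over `F_q[T]`: the maximum of the absolute values
`q^{deg c}` of its coefficients. -/
def HP (P : Polynomial (Polynomial Fq)) : ℝ :=
  (Fintype.card Fq : ℝ) ^ (P.support.sup fun i => (P.coeff i).natDegree)

/-- `ξ` is algebraic (over `F_q[T]`) of degree at most `n`. -/
def IsAlgDegLe (ξ : K Fq) (n : ℕ) : Prop :=
  ∃ P : Polynomial (Polynomial Fq), P ≠ 0 ∧ P.natDegree ≤ n ∧ evalK Fq P ξ = 0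

/-- `ξ` is algebraic over `F_q[T]`. -/
def IsAlgK (ξ : K Fq) : Prop :=
  ∃ P : Polynomial (Polynomial Fq), P ≠ 0 ∧ evalK Fq P ξ = 0

/-- The degree of an algebraic element of `F_q((T⁻¹))`. -/
def degA (α : K Fq) : ℕ :=
  sInf {d | ∃ P : Polynomial (Polynomial Fq), P ≠ 0 ∧ P.natDegree = d ∧ evalK Fq P α = 0}

/-- The height of an algebraic element `α` of `F_q((T⁻¹))`: the least height of a
 nonzero annihilating polynomial of minimal degree (= height of the minimal
 defining polynomial over `F_q[T]`). -/
def HA (α : K Fq) : ℝ :=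
  sInf {h | ∃ P : Polynomial (Polynomial Fq),
    P ≠ 0 ∧ P.natDegree = degA Fq α ∧ evalK Fq P α = 0 ∧ h = HP Fq P}

/-- The defining set for Mahler's exponent `w_n`. -/
def wnSet (ξ : K Fq) (n : ℕ) : Set ℝ :=
  {w | {P : Polynomial (Polynomial Fq) |
      P.natDegree ≤ n ∧ 0 < absK Fq (evalK Fq P ξ) ∧
      absK Fq (evalK Fq P ξ) < HP Fq P ^ (-w)}.Infinite}

/-- Mahler's exponent `w_n(ξ)`. -/
def wn (ξ : K Fq) (n : ℕ) : EReal :=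
  sSup ((fun w : ℝ => (w : EReal)) '' wnSet Fq ξ n)

/-- The defining set for `w_n^{sep}` (separable polynomials only). -/
def wnsepSet (ξ : K Fq) (n : ℕ) : Set ℝ :=
  {w | {P : Polynomial (Polynomial Fq) |
      P.Separable ∧ P.natDegree ≤ n ∧ 0 < absK Fq (evalK Fq P ξ) ∧
      absK Fq (evalK Fq P ξ) < HP Fq P ^ (-w)}.Infinite}

/-- The exponent `w_n^{sep}(ξ)`. -/
def wnsep (ξ : K Fq) (n : ℕ) : EReal :=
  sSup ((fun w : ℝ => (w : EReal)) '' wnsepSet Fq ξ n)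

/-- The defining set for Koksma's exponent `w_n^*` (approximation by algebraic
elements lying in `F_q((T⁻¹))`). -/
def wnstarSet (ξ : K Fq) (n : ℕ) : Set ℝ :=
  {w | {α : K Fq | IsAlgK Fq α ∧ degA Fq α ≤ n ∧ 0 < absK Fq (ξ - α) ∧
      absK Fq (ξ - α) < HA Fq α ^ (-w - 1)}.Infinite}

/-- Koksma's exponent `w_n^*(ξ)`. -/
def wnstar (ξ : K Fq) (n : ℕ) : EReal :=
  sSup ((fun w : ℝ => (w : EReal)) '' wnstarSet Fq ξ n)

/-- The defining set for the uniform exponent `ŵ_n`. -/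
def hwnSet (ξ : K Fq) (n : ℕ) : Set ℝ :=
  {w | ∃ H0 : ℝ, ∀ H : ℝ, H0 < H → ∃ P : Polynomial (Polynomial Fq),
      P.natDegree ≤ n ∧ HP Fq P ≤ H ∧ 0 < absK Fq (evalK Fq P ξ) ∧
      absK Fq (evalK Fq P ξ) < H ^ (-w)}

/-- The uniform exponent `ŵ_n(ξ)`. -/
def hwn (ξ : K Fq) (n : ℕ) : EReal :=
  sSup ((fun w : ℝ => (w : EReal)) '' hwnSet Fq ξ n)

/-- The defining set for the uniform exponent `ŵ_n^{sep}` (separable polynomials only). -/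
def hwnsepSet (ξ : K Fq) (n : ℕ) : Set ℝ :=
  {w | ∃ H0 : ℝ, ∀ H : ℝ, H0 < H → ∃ P : Polynomial (Polynomial Fq),
      P.Separable ∧ P.natDegree ≤ n ∧ HP Fq P ≤ H ∧ 0 < absK Fq (evalK Fq P ξ) ∧
      absK Fq (evalK Fq P ξ) < H ^ (-w)}

/-- The uniform exponent `ŵ_n^{sep}(ξ)`. -/
def hwnsep (ξ : K Fq) (n : ℕ) : EReal :=
  sSup ((fun w : ℝ => (w : EReal)) '' hwnsepSet Fq ξ n)

/-- The fractional part of a Laurent series in `T⁻¹`: the part with only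
 negative powers of `T` (positive powers of the series variable `t = T⁻¹`). -/
def fracPart (η : K Fq) : K Fq :=
  { coeff := fun m => if 0 < m then η.coeff m else 0
    isPWO_support' := η.isPWO_support'.mono (fun m hm => by
      by_cases h : 0 < m
      · simpa [Function.mem_support, h] using hm
      · simp [Function.mem_support, h] at hm) }

/-- The fractional-part norm `‖η‖ = |η - [η]|`. -/
def fracNorm (η : K Fq) : ℝ := absK Fq (fracPart Fq η)

/-- `max{‖R(T)ξ‖, …, ‖R(T)ξⁿ‖}`. -/
def maxFrac (ξ : K Fq) (n : ℕ) (R : Polynomial Fq) : ℝ :=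
  sSup ((fun i => fracNorm Fq (emb Fq R * ξ ^ i)) '' Set.Icc 1 n)

/-- The defining set for the exponent of simultaneous approximation `λ_n`. -/
def lamSet (ξ : K Fq) (n : ℕ) : Set ℝ :=
  {l | {R : Polynomial Fq | 0 < maxFrac Fq ξ n R ∧
      maxFrac Fq ξ n R < (Fintype.card Fq : ℝ) ^ (-(l * R.natDegree))}.Infinite}

/-- The exponent of simultaneous approximation `λ_n(ξ)`. -/
def lam (ξ : K Fq) (n : ℕ) : EReal :=
  sSup ((fun w : ℝ => (w : EReal)) '' lamSet Fq ξ n)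

/-- The defining set for the uniform exponent `λ̂_n`. -/
def hlamSet (ξ : K Fq) (n : ℕ) : Set ℝ :=
  {l | ∃ d0 : ℕ, ∀ d : ℕ, d0 < d → ∃ R : Polynomial Fq, R.natDegree ≤ d ∧
      0 < maxFrac Fq ξ n R ∧
      maxFrac Fq ξ n R < (Fintype.card Fq : ℝ) ^ (-(l * d))}

/-- The uniform exponent `λ̂_n(ξ)`. -/
def hlam (ξ : K Fq) (n : ℕ) : EReal :=
  sSup ((fun w : ℝ => (w : EReal)) '' hlamSet Fq ξ n)

/-- An algebraic closure of `F_q((T⁻¹))`; its algebraic elements are exactly the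
algebraic elements of the completion `C_∞`. -/
abbrev Kbar := AlgebraicClosure (K Fq)

/-- The embedding of `F_q[T]` into the algebraic closure. -/
def embbar : Polynomial Fq →+* Kbar Fq :=
  (algebraMap (K Fq) (Kbar Fq)).comp (emb Fq)

/-- Evaluation of `P ∈ F_q[T][X]` at a point of the algebraic closure. -/
def evalKbar (P : Polynomial (Polynomial Fq)) (x : Kbar Fq) : Kbar Fq :=
  P.eval₂ (embbar Fq) x

/-- The unique extension of the absolute value of `F_q((T⁻¹))` to its algebraic
closure: `|x| = |N(x)|^{1/d} = |a_0|^{1/d}` where `a_0` is the constant term and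
`d` the degree of the minimal polynomial of `x` over `F_q((T⁻¹))`. -/
def absC (x : Kbar Fq) : ℝ :=
  absK Fq ((minpoly (K Fq) x).coeff 0) ^ ((1 : ℝ) / (minpoly (K Fq) x).natDegree)

/-- `x ∈ C_∞` is algebraic over `F_q[T]`. -/
def IsAlgKbar (x : Kbar Fq) : Prop :=
  ∃ P : Polynomial (Polynomial Fq), P ≠ 0 ∧ evalKbar Fq P x = 0

/-- Degree over `F_q[T]` of an algebraic element of `C_∞`. -/
def degAbar (x : Kbar Fq) : ℕ :=
  sInf {d | ∃ P : Polynomial (Polynomial Fq), P ≠ 0 ∧ P.natDegree = d ∧ evalKbar Fq P x = 0}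

/-- Height of an algebraic element of `C_∞`. -/
def HAbar (x : Kbar Fq) : ℝ :=
  sInf {h | ∃ P : Polynomial (Polynomial Fq),
    P ≠ 0 ∧ P.natDegree = degAbar Fq x ∧ evalKbar Fq P x = 0 ∧ h = HP Fq P}

/-- The defining set for the exponent `w_n^@` (approximation by algebraic
elements of `C_∞`). -/
def wnAtSet (ξ : K Fq) (n : ℕ) : Set ℝ :=
  {w | {α : Kbar Fq | IsAlgKbar Fq α ∧ degAbar Fq α ≤ n ∧
      0 < absC Fq (algebraMap (K Fq) (Kbar Fq) ξ - α) ∧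
      absC Fq (algebraMap (K Fq) (Kbar Fq) ξ - α) < HAbar Fq α ^ (-w - 1)}.Infinite}

/-- The exponent `w_n^@(ξ)`. -/
def wnAt (ξ : K Fq) (n : ℕ) : EReal :=
  sSup ((fun w : ℝ => (w : EReal)) '' wnAtSet Fq ξ n)

/-- The defining set for the uniform exponent `ŵ_n^@`. -/
def hwnAtSet (ξ : K Fq) (n : ℕ) : Set ℝ :=
  {w | ∃ H0 : ℝ, ∀ H : ℝ, H0 < H → ∃ α : Kbar Fq, IsAlgKbar Fq α ∧ degAbar Fq α ≤ n ∧
      HAbar Fq α ≤ H ∧ 0 < absC Fq (algebraMap (K Fq) (Kbar Fq) ξ - α) ∧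
      absC Fq (algebraMap (K Fq) (Kbar Fq) ξ - α) < (HAbar Fq α)⁻¹ * H ^ (-w)}

/-- The uniform exponent `ŵ_n^@(ξ)`. -/
def hwnAt (ξ : K Fq) (n : ℕ) : EReal :=
  sSup ((fun w : ℝ => (w : EReal)) '' hwnAtSet Fq ξ n)

/-- `w(ξ) = limsup_n w_n(ξ)/n`. -/
def wlim (ξ : K Fq) : EReal :=
  Filter.atTop.limsup fun n : ℕ => wn Fq ξ n * (((n : ℝ)⁻¹ : ℝ) : EReal)

/-- `w^*(ξ) = limsup_n w_n^*(ξ)/n`. -/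
def wlimstar (ξ : K Fq) : EReal :=
  Filter.atTop.limsup fun n : ℕ => wnstar Fq ξ n * (((n : ℝ)⁻¹ : ℝ) : EReal)

/-- Height of a polynomial over `C_∞`: maximum of the absolute values of its
coefficients. -/
def HC (P : Polynomial (Kbar Fq)) : ℝ :=
  sSup ((fun i => absC Fq (P.coeff i)) '' Set.Iic P.natDegree)



theorem card_gt_one (Fq : Type) [Field Fq] [Fintype Fq] : (1:ℝ) < (Fintype.card Fq : ℝ) := by
  exact_mod_cast Fintype.one_lt_card

theorem val_eq_exp (Fq : Type) [Field Fq] (f : LaurentSeries Fq) (hf : f ≠ 0) :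
    (Valued.v f : WithZero (Multiplicative ℤ)) = WithZero.exp (-(HahnSeries.order f)) := by
  apply le_antisymm
  · rw [LaurentSeries.valuation_le_iff_coeff_lt_eq_zero]
    intro n hn
    exact HahnSeries.coeff_eq_zero_of_lt_order hn
  · by_contra h
    push Not at h
    have : (Valued.v f : WithZero (Multiplicative ℤ)) ≤ WithZero.exp (-(HahnSeries.order f + 1)) := by
      have h0 : (Valued.v f : WithZero (Multiplicative ℤ)) ≠ 0 := by simpa using hf
      obtain ⟨k, hk⟩ : ∃ k : ℤ, (Valued.v f : WithZero (Multiplicative ℤ)) = WithZero.exp k := 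
        ⟨_, (WithZero.exp_log h0).symm⟩
      rw [hk] at h ⊢
      rw [WithZero.exp_lt_exp] at h
      rw [WithZero.exp_le_exp]
      omega
    rw [LaurentSeries.valuation_le_iff_coeff_lt_eq_zero] at this
    exact HahnSeries.coeff_order_eq_zero.not.mpr hf (this _ (by omega))

theorem absK_eq (Fq : Type) [Field Fq] [Fintype Fq] (e : NNReal) (he : e ≠ 0)
    (hq : (e : ℝ) = Fintype.card Fq) (f : K Fq) :
    absK Fq f = (WithZeroMulInt.toNNReal he (Valued.v f : WithZero (Multiplicative ℤ)) : NNReal) := by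
  by_cases hf : f = 0
  · simp [absK, hf]
  · rw [absK, if_neg hf, val_eq_exp Fq f hf, WithZeroMulInt.toNNReal_neg_apply he WithZero.exp_ne_zero]
    rw [← hq]
    push_cast
    rfl

theorem exists_spectral (k L : Type) [NontriviallyNormedField k] [IsUltrametricDist k]
    [CompleteSpace k] [Field L] [Algebra k L] [Algebra.IsAlgebraic k L] :
    ∃ v : AbsoluteValue L ℝ, IsNonarchimedean v ∧
      (∀ x, v x = ‖(minpoly k x).coeff 0‖ ^ ((1 : ℝ) / (minpoly k x).natDegree)) ∧
      ∀ x : k, v (algebraMap k L x) = ‖x‖ := by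
  refine ⟨{ toFun := spectralNorm k L
            map_mul' := fun x y => map_mul (spectralMulAlgNorm k L) x y
            nonneg' := fun x => spectralNorm_nonneg x
            eq_zero' := fun x => ⟨fun h => eq_zero_of_map_spectralNorm_eq_zero h
              (Algebra.IsAlgebraic.isAlgebraic x), fun h => by rw [h]; exact spectralNorm_zero⟩
            add_le' := fun x y => map_add_le_add (spectralMulAlgNorm k L) x y }, ?_, ?_, ?_⟩
  · exact isNonarchimedean_spectralNorm
  · intro x
    exact spectralNorm.spectralNorm_eq_norm_coeff_zero_rpow k L x
  · intro x
    exact spectralNorm_extends x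

theorem exists_absC (Fq : Type) [Field Fq] [Fintype Fq] :
    ∃ v : AbsoluteValue (Kbar Fq) ℝ, IsNonarchimedean v ∧ (∀ x, v x = absC Fq x) ∧
      ∀ x : K Fq, v (algebraMap (K Fq) (Kbar Fq) x) = absK Fq x := by
  obtain ⟨e, he0⟩ : ∃ e : NNReal, (e : ℝ) = Fintype.card Fq := ⟨(Fintype.card Fq : NNReal), by simp⟩
  have he1 : 1 < e := by
    have := card_gt_one Fq
    rw [← he0] at this
    exact_mod_cast this
  let vv : Valuation (K Fq) (WithZero (Multiplicative ℤ)) := Valued.v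
  let ro : Valuation.RankOne vv :=
    { hom' := (WithZeroMulInt.toNNReal he1.ne_zero).comp MonoidWithZeroHom.ValueGroup₀.embedding
      strictMono' := (WithZeroMulInt.toNNReal_strictMono he1).comp
        MonoidWithZeroHom.ValueGroup₀.embedding_strictMono
      exists_val_nontrivial := by
        refine ⟨HahnSeries.single 1 1, ?_, ?_⟩
        · simp
        · have := LaurentSeries.valuation_single_zpow Fq 1
          show Valued.v _ ≠ _
          rw [this]
          rw [← WithZero.exp_zero, Ne, WithZero.exp_inj]
          omega }
  let nf : NontriviallyNormedField (K Fq) := Valued.toNontriviallyNormedField (L := K Fq) (Γ₀ := WithZero (Multiplicative ℤ))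
  have : IsUltrametricDist (K Fq) := inferInstance
  have : CompleteSpace (K Fq) := inferInstance
  have hn : ∀ x : K Fq, ‖x‖ = absK Fq x := by
    intro x
    rw [absK_eq Fq e he1.ne_zero he0]
    have h1 : ‖x‖ = (ro.hom' (vv.restrict x) : NNReal) := rfl
    rw [h1]
    congr 1
    show (WithZeroMulInt.toNNReal he1.ne_zero) (MonoidWithZeroHom.ValueGroup₀.embedding (vv.restrict x)) = _
    congr 1
    exact vv.embedding_restrict x
  obtain ⟨v, h1, h2, h3⟩ := exists_spectral (K Fq) (Kbar Fq)
  refine ⟨v, h1, fun x => ?_, fun x => ?_⟩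
  · rw [h2, absC, hn]
  · rw [h3, hn]

section abstractpart

theorem gauss_X_sub_C {L : Type} [Field L] (v : AbsoluteValue L ℝ) (s : L) (r : ℝ) (hr : 0 < r) :
    (X - C s).gaussNorm v r = max r (v s) := by
  apply le_antisymm
  · obtain ⟨i, hi⟩ := Polynomial.exists_eq_gaussNorm v r (X - C s)
    rw [hi]
    rcases i with _ | _ | i
    · simp
    · simp [coeff_X, coeff_C]
    · simp [coeff_X, coeff_C, hr.le]
  · apply max_le
    · have := Polynomial.le_gaussNorm v (X - C s) hr.le 1
      simpa [coeff_X, coeff_C] using this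
    · have := Polynomial.le_gaussNorm v (X - C s) hr.le 0
      simpa [coeff_X, coeff_C] using this

theorem gauss_roots {L : Type} [Field L] [IsAlgClosed L] (v : AbsoluteValue L ℝ)
    (hv : IsNonarchimedean v) (G : L[X]) (r : ℝ) (hr : 0 < r) :
    G.gaussNorm v r = v G.leadingCoeff * (G.roots.map (fun s => max r (v s))).prod := by
  have h := (IsAlgClosed.splits G).eq_prod_roots
  have key : ∀ M : Multiset L, ((M.map (fun a => X - C a)).prod).gaussNorm v r =
      (M.map (fun s => max r (v s))).prod := by
    intro M
    induction M using Multiset.induction_on with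
    | empty =>
      have := Polynomial.gaussNorm_C v r (1 : L)
      simpa using this
    | cons a M ih =>
      rw [Multiset.map_cons, Multiset.prod_cons, Polynomial.gaussNorm_mul hv hr, ih,
        gauss_X_sub_C v a r hr, Multiset.map_cons, Multiset.prod_cons]
  conv_lhs => rw [h]
  rw [Polynomial.gaussNorm_mul hv hr, key, Polynomial.gaussNorm_C]

theorem eval_le_gauss {L : Type} [Field L] (v : AbsoluteValue L ℝ)
    (hv : IsNonarchimedean v) (G : L[X]) (r : ℝ) (hr : 0 ≤ r) (x : L) (hx : v x ≤ r) :
    v (G.eval x) ≤ G.gaussNorm v r := by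
  rw [Polynomial.eval_eq_sum_range]
  obtain ⟨i, hi, h⟩ := IsNonarchimedean.finset_image_add (f := v) (map_zero v)
    (fun a => v.nonneg a) hv (fun i => G.coeff i * x ^ i) (Finset.range (G.natDegree + 1))
  refine h.trans (le_trans ?_ (Polynomial.le_gaussNorm v G hr i))
  rw [map_mul, map_pow]
  gcongr

theorem gauss_le_of_coeff {L : Type} [Field L] (v : AbsoluteValue L ℝ)
    (G : L[X]) (r B : ℝ) (h : ∀ i, v (G.coeff i) * r ^ i ≤ B) :
    G.gaussNorm v r ≤ B := by
  obtain ⟨i, hi⟩ := Polynomial.exists_eq_gaussNorm v r G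
  rw [hi]; exact h i

theorem eval_le_gauss_one {L : Type} [Field L] (v : AbsoluteValue L ℝ)
    (hv : IsNonarchimedean v) (G : L[X]) (m : ℕ) (hm : G.natDegree ≤ m) (x : L) :
    v (G.eval x) ≤ G.gaussNorm v 1 * (max 1 (v x)) ^ m := by
  have h1 : (1 : ℝ) ≤ max 1 (v x) := le_max_left _ _
  refine (eval_le_gauss v hv G (max 1 (v x)) (by positivity) x (le_max_right _ _)).trans ?_
  apply gauss_le_of_coeff
  intro i
  by_cases hi : i ≤ m
  · have := Polynomial.le_gaussNorm v G zero_le_one i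
    rw [one_pow, mul_one] at this
    have hnn := Polynomial.gaussNorm_nonneg v G zero_le_one
    gcongr
  · rw [coeff_eq_zero_of_natDegree_lt (by omega), map_zero, zero_mul]
    have := Polynomial.gaussNorm_nonneg v G zero_le_one
    positivity

theorem two_roots {k L : Type} [Field k] [Field L] [Algebra k L] [IsAlgClosed L]
    [Algebra.IsAlgebraic k L]
    (v : AbsoluteValue L ℝ) (hc : ∀ x y : L, minpoly k x = minpoly k y → v x = v y)
    (F : k[X]) (hF : F ≠ 0) (s : L) (hs : aeval s F = 0)
    (hns : ∀ x : k, algebraMap k L x ≠ s) :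
    ∃ (s2 : L) (M : Multiset L), v s2 = v s ∧ (F.map (algebraMap k L)).roots = s ::ₘ s2 ::ₘ M := by
  have hsint : IsIntegral k s := Algebra.IsIntegral.isIntegral s
  have hd : 2 ≤ (minpoly k s).natDegree := by
    have h0 := minpoly.natDegree_pos hsint
    by_contra h
    have h1 : (minpoly k s).natDegree = 1 := by omega
    have h2 : (minpoly k s).degree = 1 := by
      rw [degree_eq_natDegree (minpoly.ne_zero hsint), h1]; rfl
    obtain ⟨x, hx⟩ := minpoly.mem_range_of_degree_eq_one k s h2
    exact hns x hx
  have hdvd : minpoly k s ∣ F := minpoly.dvd k s hs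
  have hle : ((minpoly k s).map (algebraMap k L)).roots ≤ (F.map (algebraMap k L)).roots :=
    roots.le_of_dvd (by simpa using hF) (Polynomial.map_dvd _ hdvd)
  have hcard : ((minpoly k s).map (algebraMap k L)).roots.card = (minpoly k s).natDegree := by
    have := splits_iff_card_roots.mp (IsAlgClosed.splits ((minpoly k s).map (algebraMap k L)))
    rw [this, natDegree_map]
  have hmem : s ∈ ((minpoly k s).map (algebraMap k L)).roots := by
    rw [mem_roots (by simpa using minpoly.ne_zero hsint), IsRoot.def, eval_map_algebraMap,
      minpoly.aeval]
  obtain ⟨M1, hM1⟩ := Multiset.exists_cons_of_mem hmem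
  have hM1c : 0 < M1.card := by
    rw [hM1, Multiset.card_cons] at hcard; omega
  obtain ⟨s2, hs2⟩ := Multiset.card_pos_iff_exists_mem.mp hM1c
  obtain ⟨M2, hM2⟩ := Multiset.exists_cons_of_mem hs2
  obtain ⟨M3, hM3⟩ := Multiset.le_iff_exists_add.mp hle
  refine ⟨s2, M2 + M3, ?_, ?_⟩
  · apply hc
    have hs2' : s2 ∈ ((minpoly k s).map (algebraMap k L)).roots := by
      rw [hM1]; exact Multiset.mem_cons_of_mem hs2
    rw [mem_roots (by simpa using minpoly.ne_zero hsint), IsRoot.def, eval_map_algebraMap] at hs2'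
    exact (minpoly.eq_of_root (Algebra.IsAlgebraic.isAlgebraic s) hs2')
  · rw [hM3, hM1, hM2]; simp [Multiset.cons_add]

theorem gauss_two {L : Type} [Field L] [IsAlgClosed L] (v : AbsoluteValue L ℝ)
    (hv : IsNonarchimedean v) (G : L[X]) (s1 s2 : L) (M : Multiset L)
    (hM : G.roots = s1 ::ₘ s2 ::ₘ M) (r : ℝ) (hr : 0 < r) (hr1 : r ≤ 1) (h1 : v s1 ≤ r)
    (h2 : v s2 ≤ r) : G.gaussNorm v r ≤ G.gaussNorm v 1 * r ^ 2 := by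
  rw [gauss_roots v hv G r hr, gauss_roots v hv G 1 one_pos, hM]
  simp only [Multiset.map_cons, Multiset.prod_cons]
  rw [max_eq_left h1, max_eq_left h2, max_eq_left (h1.trans hr1), max_eq_left (h2.trans hr1)]
  have : (M.map (fun s => max r (v s))).prod ≤ (M.map (fun s => max 1 (v s))).prod := by
    apply Multiset.prod_map_le_prod_map₀
    · intro i _; positivity
    · intro i _; exact max_le_max hr1 le_rfl
  have hlc := v.nonneg G.leadingCoeff
  calc v G.leadingCoeff * (r * (r * (M.map (fun s => max r (v s))).prod))
      ≤ v G.leadingCoeff * (r * (r * (M.map (fun s => max 1 (v s))).prod)) := by gcongr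
    _ = _ := by ring

theorem lemmaA {k L : Type} [Field k] [Field L] [Algebra k L] [IsAlgClosed L]
    [Algebra.IsAlgebraic k L]
    (v : AbsoluteValue L ℝ) (hv : IsNonarchimedean v)
    (hc : ∀ x y : L, minpoly k x = minpoly k y → v x = v y)
    (F : k[X]) (hF : F ≠ 0) (r : ℝ) (hr : 0 < r) (hr1 : r ≤ 1)
    (hno : ∀ x : k, F.eval x = 0 → r ≤ v (algebraMap k L x)) :
    (F.map (algebraMap k L)).gaussNorm v r ≤
      max (v (algebraMap k L (F.coeff 0))) ((F.map (algebraMap k L)).gaussNorm v 1 * r ^ 2) := by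
  set G := F.map (algebraMap k L) with hG
  have hG0 : G ≠ 0 := by simpa [hG] using hF
  by_cases h : ∃ s ∈ G.roots, v s < r
  · obtain ⟨s, hs, hsr⟩ := h
    have hs0 : aeval s F = 0 := by
      rw [mem_roots hG0, IsRoot.def, hG, eval_map_algebraMap] at hs
      exact hs
    obtain ⟨s2, M, h2, hM⟩ := two_roots v hc F hF s hs0 (by
      intro x hx
      have : F.eval x = 0 := by
        rw [← hx, aeval_algebraMap_apply, coe_aeval_eq_eval] at hs0
        simpa using hs0
      have := hno x this
      rw [hx] at this
      linarith)
    exact (gauss_two v hv G s s2 M hM r hr hr1 hsr.le (h2.le.trans hsr.le)).trans (le_max_right _ _)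
  · push Not at h
    refine le_trans (le_of_eq ?_) (le_max_left _ _)
    rw [gauss_roots v hv G r hr]
    have e1 : algebraMap k L (F.coeff 0) = G.coeff 0 := by simp [hG]
    rw [e1, (IsAlgClosed.splits G).coeff_zero_eq_leadingCoeff_mul_prod_roots]
    simp only [map_mul, map_pow, AbsoluteValue.map_neg, map_one, one_pow, one_mul, map_multiset_prod]
    congr 2
    apply Multiset.map_congr rfl
    intro s hs
    exact max_eq_right (h s hs)

theorem prod_one_bound {L : Type} [Field L] [IsAlgClosed L] (v : AbsoluteValue L ℝ)
    (hv : IsNonarchimedean v) (Q : L[X]) (m : ℕ) (hm : Q.natDegree ≤ m) (M : Multiset L) :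
    (M.map (fun s => v (Q.eval s))).prod ≤
      (Q.gaussNorm v 1) ^ M.card * ((M.map (fun s => max 1 (v s))).prod) ^ m := by
  have h0 := Polynomial.gaussNorm_nonneg v Q zero_le_one
  induction M using Multiset.induction_on with
  | empty => simp
  | cons a M ih =>
    simp only [Multiset.map_cons, Multiset.prod_cons, Multiset.card_cons]
    have := eval_le_gauss_one v hv Q m hm a
    have hp : 0 ≤ (M.map (fun s => v (Q.eval s))).prod := by
      apply Multiset.prod_nonneg
      intro x hx
      obtain ⟨y, _, rfl⟩ := Multiset.mem_map.mp hx
      exact v.nonneg _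
    calc _ ≤ (Q.gaussNorm v 1 * (max 1 (v a)) ^ m) * ((Q.gaussNorm v 1) ^ M.card * ((M.map (fun s => max 1 (v s))).prod) ^ m) := by
          gcongr
      _ = _ := by ring

theorem res_one {L : Type} [Field L] [IsAlgClosed L] (v : AbsoluteValue L ℝ)
    (hv : IsNonarchimedean v) (P Q : L[X]) (m : ℕ) (hm : Q.natDegree ≤ m) (s1 : L) (M : Multiset L)
    (hM : P.roots = s1 ::ₘ M) (hs : v s1 ≤ 1) :
    v P.leadingCoeff ^ m * (P.roots.map (fun s => v (Q.eval s))).prod ≤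
      v (Q.eval s1) * Q.gaussNorm v 1 ^ M.card * P.gaussNorm v 1 ^ m := by
  have h0 := Polynomial.gaussNorm_nonneg v Q zero_le_one
  rw [gauss_roots v hv P 1 one_pos, hM]
  simp only [Multiset.map_cons, Multiset.prod_cons]
  rw [max_eq_left hs]
  have := prod_one_bound v hv Q m hm M
  have hlc := v.nonneg P.leadingCoeff
  have hq := v.nonneg (Q.eval s1)
  calc _ ≤ v P.leadingCoeff ^ m * (v (Q.eval s1) * ((Q.gaussNorm v 1) ^ M.card * ((M.map (fun s => max 1 (v s))).prod) ^ m)) := by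
        gcongr
    _ = _ := by ring

theorem res_two {L : Type} [Field L] [IsAlgClosed L] (v : AbsoluteValue L ℝ)
    (hv : IsNonarchimedean v) (P Q : L[X]) (m : ℕ) (hm : Q.natDegree ≤ m) (s1 s2 : L) (M : Multiset L)
    (hM : P.roots = s1 ::ₘ s2 ::ₘ M) (r : ℝ) (hr1 : r ≤ 1) (h1 : v s1 ≤ r) (h2 : v s2 ≤ r) :
    v P.leadingCoeff ^ m * (P.roots.map (fun s => v (Q.eval s))).prod ≤
      Q.gaussNorm v r ^ 2 * Q.gaussNorm v 1 ^ M.card * P.gaussNorm v 1 ^ m := by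
  have hr : 0 ≤ r := (v.nonneg s1).trans h1
  have h0 := Polynomial.gaussNorm_nonneg v Q zero_le_one
  have h0r := Polynomial.gaussNorm_nonneg v Q hr
  rw [gauss_roots v hv P 1 one_pos, hM]
  simp only [Multiset.map_cons, Multiset.prod_cons]
  rw [max_eq_left (h1.trans hr1), max_eq_left (h2.trans hr1)]
  have := prod_one_bound v hv Q m hm M
  have hlc := v.nonneg P.leadingCoeff
  have hq1 := eval_le_gauss v hv Q r hr s1 h1
  have hq2 := eval_le_gauss v hv Q r hr s2 h2
  have hn1 := v.nonneg (Q.eval s1)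
  have hn2 := v.nonneg (Q.eval s2)
  have hp : 0 ≤ (M.map (fun s => v (Q.eval s))).prod := by
    apply Multiset.prod_nonneg
    intro x hx
    obtain ⟨y, _, rfl⟩ := Multiset.mem_map.mp hx
    exact v.nonneg _
  calc _ ≤ v P.leadingCoeff ^ m * (Q.gaussNorm v r * (Q.gaussNorm v r * ((Q.gaussNorm v 1) ^ M.card * ((M.map (fun s => max 1 (v s))).prod) ^ m))) := by
        gcongr
    _ = _ := by ring

theorem res_four {L : Type} [Field L] [IsAlgClosed L] (v : AbsoluteValue L ℝ)
    (hv : IsNonarchimedean v) (P Q : L[X]) (l : ℕ) (hm : Q.natDegree ≤ l + 2)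
    (r A : ℝ) (hr : 0 < r) (hr1 : r ≤ 1) (hA : 0 ≤ A)
    (hP1 : P.gaussNorm v 1 ≤ A) (hQ1 : Q.gaussNorm v 1 ≤ A)
    (hPr : P.gaussNorm v r ≤ A * r ^ 2) (hQr : Q.gaussNorm v r ≤ A * r ^ 2) :
    v P.leadingCoeff ^ (l + 2) * (P.roots.map (fun s => v (Q.eval s))).prod ≤
      A ^ P.natDegree * A ^ (l + 2) * r ^ 4 := by
  have hev : ∀ s, v (Q.eval s) ≤ A * (max r (v s)) ^ 2 * (max 1 (v s)) ^ l := by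
    intro s
    set ρ := max r (v s) with hρ
    have hrρ : r ≤ ρ := le_max_left _ _
    have hρ0 : 0 < ρ := hr.trans_le hrρ
    have h1 : (1 : ℝ) ≤ max 1 (v s) := le_max_left _ _
    refine (eval_le_gauss v hv Q ρ hρ0.le s (le_max_right _ _)).trans ?_
    have hml : (1 : ℝ) ≤ (max 1 (v s)) ^ l := one_le_pow₀ h1
    have hstep : ∀ i, v (Q.coeff i) * ρ ^ i ≤ A * ρ ^ 2 * (max 1 (v s)) ^ l := by
      intro i
      have hg1 := (Polynomial.le_gaussNorm v Q zero_le_one i).trans hQ1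
      have hgr := (Polynomial.le_gaussNorm v Q hr.le i).trans hQr
      rw [one_pow, mul_one] at hg1
      have hn := v.nonneg (Q.coeff i)
      rcases i with _ | _ | i
      · calc v (Q.coeff 0) * ρ ^ 0 ≤ A * r ^ 2 := by simpa using hgr
          _ ≤ A * ρ ^ 2 := by gcongr
          _ ≤ _ := le_mul_of_one_le_right (by positivity) hml
      · have : v (Q.coeff 1) ≤ A * r := by
          have h3 : v (Q.coeff 1) * r ≤ (A * r) * r := by
            simp only [zero_add, pow_one] at hgr
            nlinarith
          exact le_of_mul_le_mul_right h3 hr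
        calc v (Q.coeff (0 + 1)) * ρ ^ (0 + 1) ≤ (A * r) * ρ := by
              simp only [zero_add, pow_one]; gcongr
          _ ≤ (A * ρ) * ρ := by gcongr
          _ = A * ρ ^ 2 := by ring
          _ ≤ _ := le_mul_of_one_le_right (by positivity) hml
      · by_cases hi : i ≤ l
        · have hρm : ρ ≤ max 1 (v s) := max_le_max hr1 le_rfl
          calc v (Q.coeff (i + 1 + 1)) * ρ ^ (i + 1 + 1) ≤ A * ρ ^ (i + 1 + 1) := by gcongr
            _ = A * ρ ^ 2 * ρ ^ i := by ring
            _ ≤ A * ρ ^ 2 * (max 1 (v s)) ^ i := by gcongr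
            _ ≤ A * ρ ^ 2 * (max 1 (v s)) ^ l := by gcongr
        · rw [coeff_eq_zero_of_natDegree_lt (by omega), map_zero, zero_mul]
          positivity
    exact gauss_le_of_coeff v Q ρ _ hstep
  have hprod : ∀ M : Multiset L, (M.map (fun s => v (Q.eval s))).prod ≤
      A ^ M.card * ((M.map (fun s => max r (v s))).prod) ^ 2 * ((M.map (fun s => max 1 (v s))).prod) ^ l := by
    intro M
    induction M using Multiset.induction_on with
    | empty => simp
    | cons a M ih =>
      simp only [Multiset.map_cons, Multiset.prod_cons, Multiset.card_cons]
      have := hev a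
      have hp : 0 ≤ (M.map (fun s => v (Q.eval s))).prod := by
        apply Multiset.prod_nonneg
        intro x hx
        obtain ⟨y, _, rfl⟩ := Multiset.mem_map.mp hx
        exact v.nonneg _
      calc _ ≤ (A * (max r (v a)) ^ 2 * (max 1 (v a)) ^ l) * (A ^ M.card * ((M.map (fun s => max r (v s))).prod) ^ 2 * ((M.map (fun s => max 1 (v s))).prod) ^ l) := by
            gcongr
        _ = _ := by ring
  have hlc := v.nonneg P.leadingCoeff
  have hcard : P.roots.card = P.natDegree := (splits_iff_card_roots.mp (IsAlgClosed.splits P)).symm ▸ rfl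
  have h1n := Polynomial.gaussNorm_nonneg v P zero_le_one
  have hrn := Polynomial.gaussNorm_nonneg v P hr.le
  calc _ ≤ v P.leadingCoeff ^ (l + 2) * (A ^ P.roots.card * ((P.roots.map (fun s => max r (v s))).prod) ^ 2 * ((P.roots.map (fun s => max 1 (v s))).prod) ^ l) := by
        gcongr; exact hprod _
    _ = A ^ P.natDegree * (P.gaussNorm v r) ^ 2 * (P.gaussNorm v 1) ^ l := by
        rw [gauss_roots v hv P 1 one_pos, gauss_roots v hv P r hr, hcard]; ring
    _ ≤ A ^ P.natDegree * (A * r ^ 2) ^ 2 * A ^ l := by gcongr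
    _ = _ := by ring

end abstractpart

section arith

/-- the absolute value on the algebraic closure, bundled. -/
def vC (Fq : Type) [Field Fq] [Fintype Fq] : AbsoluteValue (Kbar Fq) ℝ := (exists_absC Fq).choose

theorem vC_na (Fq : Type) [Field Fq] [Fintype Fq] : IsNonarchimedean (vC Fq) :=
  (exists_absC Fq).choose_spec.1

theorem vC_eq (Fq : Type) [Field Fq] [Fintype Fq] (x : Kbar Fq) : vC Fq x = absC Fq x :=
  (exists_absC Fq).choose_spec.2.1 x

theorem vC_alg (Fq : Type) [Field Fq] [Fintype Fq] (x : K Fq) :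
    vC Fq (algebraMap (K Fq) (Kbar Fq) x) = absK Fq x :=
  (exists_absC Fq).choose_spec.2.2 x

theorem vC_minpoly (Fq : Type) [Field Fq] [Fintype Fq] (x y : Kbar Fq)
    (h : minpoly (K Fq) x = minpoly (K Fq) y) : vC Fq x = vC Fq y := by
  rw [vC_eq, vC_eq, absC, absC, h]

theorem algKC (Fq : Type) [Field Fq] [Fintype Fq] (c : Fq) :
    algebraMap Fq (K Fq) c = HahnSeries.single 0 c := by
  have h : algebraMap Fq (K Fq) c = HahnSeries.ofPowerSeries ℤ Fq (algebraMap Fq (PowerSeries Fq) c) := rfl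
  rw [h, ← HahnSeries.C_apply, ← HahnSeries.ofPowerSeries_C]
  rfl

theorem emb_monomial (Fq : Type) [Field Fq] [Fintype Fq] (i : ℕ) (c : Fq) :
    emb Fq (monomial i c) = HahnSeries.single (-(i : ℤ)) c := by
  rw [emb, coe_eval₂RingHom, eval₂_monomial, algKC, Tvar, HahnSeries.single_pow,
    HahnSeries.single_mul_single]
  simp

theorem emb_coeff (Fq : Type) [Field Fq] [Fintype Fq] (a : Polynomial Fq) (k : ℤ) :
    (emb Fq a).coeff k = if k ≤ 0 then a.coeff (-k).toNat else 0 := by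
  induction a using Polynomial.induction_on' with
  | add p q hp hq =>
    rw [map_add, HahnSeries.coeff_add, hp, hq]
    split_ifs <;> simp
  | monomial i c =>
    rw [emb_monomial, HahnSeries.coeff_single, coeff_monomial]
    split_ifs <;> first | rfl | omega

theorem emb_ne_zero (Fq : Type) [Field Fq] [Fintype Fq] (a : Polynomial Fq) (ha : a ≠ 0) :
    emb Fq a ≠ 0 := by
  intro h
  have := emb_coeff Fq a (-(a.natDegree : ℤ))
  rw [h] at this
  simp at this
  exact ha (leadingCoeff_eq_zero.mp this.symm)

theorem emb_inj (Fq : Type) [Field Fq] [Fintype Fq] : Function.Injective (emb Fq) := by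
  rw [injective_iff_map_eq_zero]
  intro a ha
  by_contra h
  exact emb_ne_zero Fq a h ha

theorem embbar_inj (Fq : Type) [Field Fq] [Fintype Fq] : Function.Injective (embbar Fq) := by
  rw [embbar, RingHom.coe_comp]
  exact (algebraMap (K Fq) (Kbar Fq)).injective.comp (emb_inj Fq)

theorem absK_emb (Fq : Type) [Field Fq] [Fintype Fq] (a : Polynomial Fq) (ha : a ≠ 0) :
    absK Fq (emb Fq a) = (Fintype.card Fq : ℝ) ^ a.natDegree := by
  have h0 := emb_ne_zero Fq a ha
  rw [absK, if_neg h0]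
  have : (emb Fq a).order = -(a.natDegree : ℤ) := by
    apply le_antisymm
    · apply HahnSeries.order_le_of_coeff_ne_zero
      rw [emb_coeff]
      simpa using ha
    · rw [HahnSeries.le_order_iff_forall h0]
      intro j hj
      rw [emb_coeff, if_pos (by omega)]
      apply coeff_eq_zero_of_natDegree_lt
      omega
  rw [this, neg_neg, zpow_natCast]

theorem vC_embbar (Fq : Type) [Field Fq] [Fintype Fq] (a : Polynomial Fq) (ha : a ≠ 0) :
    vC Fq (embbar Fq a) = (Fintype.card Fq : ℝ) ^ a.natDegree := by
  rw [embbar, RingHom.comp_apply, vC_alg, absK_emb Fq a ha]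

theorem one_le_vC_embbar (Fq : Type) [Field Fq] [Fintype Fq] (a : Polynomial Fq) (ha : a ≠ 0) :
    1 ≤ vC Fq (embbar Fq a) := by
  rw [vC_embbar Fq a ha]
  exact one_le_pow₀ (card_gt_one Fq).le

theorem HP_ge_one (Fq : Type) [Field Fq] [Fintype Fq] (P : Polynomial (Polynomial Fq)) :
    1 ≤ HP Fq P := one_le_pow₀ (card_gt_one Fq).le

theorem HP_gauss (Fq : Type) [Field Fq] [Fintype Fq] (P : Polynomial (Polynomial Fq)) (hP : P ≠ 0) :
    HP Fq P = (P.map (embbar Fq)).gaussNorm (vC Fq) 1 := by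
  apply le_antisymm
  · obtain ⟨i, hi, h⟩ := Finset.exists_mem_eq_sup P.support
      (Polynomial.support_nonempty.mpr hP) (fun i => (P.coeff i).natDegree)
    rw [HP, h]
    have := Polynomial.le_gaussNorm (vC Fq) (P.map (embbar Fq)) zero_le_one i
    rw [one_pow, mul_one, coeff_map, vC_embbar Fq _ (mem_support_iff.mp hi)] at this
    exact this
  · apply gauss_le_of_coeff
    intro i
    rw [one_pow, mul_one, coeff_map]
    by_cases h : P.coeff i = 0
    · rw [h, map_zero, map_zero]; exact zero_le_one.trans (HP_ge_one Fq P)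
    · rw [vC_embbar Fq _ h, HP]
      apply pow_le_pow_right₀ (card_gt_one Fq).le
      exact Finset.le_sup (f := fun i => (P.coeff i).natDegree) (mem_support_iff.mpr h)

theorem HP_mul (Fq : Type) [Field Fq] [Fintype Fq] (P Q : Polynomial (Polynomial Fq)) (hP : P ≠ 0)
    (hQ : Q ≠ 0) : HP Fq (P * Q) = HP Fq P * HP Fq Q := by
  rw [HP_gauss Fq _ hP, HP_gauss Fq _ hQ, HP_gauss Fq _ (mul_ne_zero hP hQ), Polynomial.map_mul,
    Polynomial.gaussNorm_mul (vC_na Fq) one_pos]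

theorem HP_dvd (Fq : Type) [Field Fq] [Fintype Fq] (P Q : Polynomial (Polynomial Fq)) (hQ : Q ≠ 0)
    (h : P ∣ Q) : HP Fq P ≤ HP Fq Q := by
  obtain ⟨R, rfl⟩ := h
  rw [HP_mul Fq P R (left_ne_zero_of_mul hQ) (right_ne_zero_of_mul hQ)]
  have h1 := HP_ge_one Fq P
  have h2 := HP_ge_one Fq R
  nlinarith

theorem evalKbar_alg (Fq : Type) [Field Fq] [Fintype Fq] (P : Polynomial (Polynomial Fq)) (x : K Fq) :
    evalKbar Fq P (algebraMap (K Fq) (Kbar Fq) x) = algebraMap (K Fq) (Kbar Fq) (evalK Fq P x) := by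
  rw [evalKbar, evalK, embbar, hom_eval₂]

theorem evalKbar_alg_zero (Fq : Type) [Field Fq] [Fintype Fq] (P : Polynomial (Polynomial Fq))
    (x : K Fq) :
    evalKbar Fq P (algebraMap (K Fq) (Kbar Fq) x) = 0 ↔ evalK Fq P x = 0 := by
  rw [evalKbar_alg, map_eq_zero]

theorem isAlg_alg (Fq : Type) [Field Fq] [Fintype Fq] (x : K Fq) :
    IsAlgKbar Fq (algebraMap (K Fq) (Kbar Fq) x) ↔ IsAlgK Fq x := by
  simp only [IsAlgKbar, IsAlgK, evalKbar_alg_zero]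

theorem degAbar_alg (Fq : Type) [Field Fq] [Fintype Fq] (x : K Fq) :
    degAbar Fq (algebraMap (K Fq) (Kbar Fq) x) = degA Fq x := by
  simp only [degAbar, degA, evalKbar_alg_zero]

theorem HAbar_alg (Fq : Type) [Field Fq] [Fintype Fq] (x : K Fq) :
    HAbar Fq (algebraMap (K Fq) (Kbar Fq) x) = HA Fq x := by
  simp only [HAbar, HA, evalKbar_alg_zero, degAbar_alg]

theorem min_dvd (Fq : Type) [Field Fq] [Fintype Fq] (P Q : Polynomial (Polynomial Fq))
    (hP : Irreducible P) (hd : 0 < P.natDegree) (x : Kbar Fq) (hx : evalKbar Fq P x = 0)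
    (hQ : evalKbar Fq Q x = 0) : P ∣ Q := by
  have hprim := hP.isPrimitive hd.ne'
  have hirr : Irreducible (P.map (algebraMap (Polynomial Fq) (FractionRing (Polynomial Fq)))) :=
    (hprim.irreducible_iff_irreducible_map_fraction_map).mp hP
  apply hprim.dvd_of_fraction_map_dvd_fraction_map (K := FractionRing (Polynomial Fq))
  rcases EuclideanDomain.dvd_or_coprime _
    (Q.map (algebraMap (Polynomial Fq) (FractionRing (Polynomial Fq)))) hirr with h | h
  · exact h
  · exfalso
    obtain ⟨a, b, hab⟩ := h
    set f : FractionRing (Polynomial Fq) →+* Kbar Fq := IsFractionRing.lift (embbar_inj Fq) with hf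
    have hcomp : f.comp (algebraMap (Polynomial Fq) (FractionRing (Polynomial Fq))) = embbar Fq := by
      apply RingHom.ext
      intro y
      rw [RingHom.comp_apply, hf, IsFractionRing.lift_algebraMap]
    have := congrArg (eval₂ f x) hab
    rw [eval₂_add, eval₂_mul, eval₂_mul, eval₂_map, eval₂_map, hcomp, eval₂_one] at this
    rw [evalKbar] at hx hQ
    rw [hx, hQ] at this
    simp at this

theorem alg_data (Fq : Type) [Field Fq] [Fintype Fq] (x : Kbar Fq) (h : IsAlgKbar Fq x) :
    ∃ P : Polynomial (Polynomial Fq), Irreducible P ∧ 0 < P.natDegree ∧ evalKbar Fq P x = 0 ∧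
      degAbar Fq x = P.natDegree ∧ HAbar Fq x = HP Fq P := by
  obtain ⟨R, hR, hRx⟩ := h
  obtain ⟨f, hf, hfR⟩ := WfDvdMonoid.exists_factors R hR
  have h0 : evalKbar Fq f.prod x = 0 := by
    obtain ⟨S, hS⟩ := hfR.symm.dvd
    rw [hS, evalKbar, eval₂_mul]
    rw [evalKbar] at hRx
    rw [hRx, zero_mul]
  have h1 : (f.map (fun P => evalKbar Fq P x)).prod = 0 := by
    have := map_multiset_prod (eval₂RingHom (embbar Fq) x) f
    rw [← h0]
    exact this.symm
  rw [Multiset.prod_eq_zero_iff, Multiset.mem_map] at h1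
  obtain ⟨P, hPf, hPx⟩ := h1
  have hPirr := hf P hPf
  have hPd : 0 < P.natDegree := by
    by_contra hd
    have hd0 : P.natDegree = 0 := by omega
    rw [natDegree_eq_zero] at hd0
    obtain ⟨c, rfl⟩ := hd0
    rw [evalKbar, eval₂_C, map_eq_zero_iff _ (embbar_inj Fq)] at hPx
    exact hPirr.ne_zero (by rw [hPx, C_0])
  have hdeg : degAbar Fq x = P.natDegree := by
    apply le_antisymm
    · exact Nat.sInf_le ⟨P, hPirr.ne_zero, rfl, hPx⟩
    · refine le_csInf ⟨P.natDegree, P, hPirr.ne_zero, rfl, hPx⟩ ?_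
      rintro d ⟨Q, hQ, rfl, hQx⟩
      exact natDegree_le_of_dvd (min_dvd Fq P Q hPirr hPd x hPx hQx) hQ
  refine ⟨P, hPirr, hPd, hPx, hdeg, ?_⟩
  apply le_antisymm
  · apply csInf_le
    · refine ⟨0, ?_⟩
      rintro h ⟨Q, hQ, hQd, hQx, rfl⟩
      exact zero_le_one.trans (HP_ge_one Fq Q)
    · exact ⟨P, hPirr.ne_zero, hdeg.symm, hPx, rfl⟩
  · refine le_csInf ⟨HP Fq P, P, hPirr.ne_zero, hdeg.symm, hPx, rfl⟩ ?_
    rintro d ⟨Q, hQ, hQd, hQx, rfl⟩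
    exact HP_dvd Fq P Q hQ (min_dvd Fq P Q hPirr hPd x hPx hQx)

theorem HAbar_ge_one (Fq : Type) [Field Fq] [Fintype Fq] (x : Kbar Fq) (h : IsAlgKbar Fq x) :
    1 ≤ HAbar Fq x := by
  obtain ⟨P, _, _, _, _, h⟩ := alg_data Fq x h
  rw [h]; exact HP_ge_one Fq P

theorem HAbar_le (Fq : Type) [Field Fq] [Fintype Fq] (x : Kbar Fq)
    (Q : Polynomial (Polynomial Fq)) (hQ : Q ≠ 0) (hx : evalKbar Fq Q x = 0) :
    degAbar Fq x ≤ Q.natDegree ∧ HAbar Fq x ≤ HP Fq Q := by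
  obtain ⟨P, hP, hd, hPx, h1, h2⟩ := alg_data Fq x ⟨Q, hQ, hx⟩
  have := min_dvd Fq P Q hP hd x hPx hx
  rw [h1, h2]
  exact ⟨natDegree_le_of_dvd this hQ, HP_dvd Fq P Q hQ this⟩

/-- Taylor expansion of `P` at `ξ`. -/
def FT (Fq : Type) [Field Fq] [Fintype Fq] (ξ : K Fq) (P : Polynomial (Polynomial Fq)) :
    Polynomial (K Fq) := taylor ξ (P.map (emb Fq))

/-- Taylor expansion of `P` at `ξ`, over the algebraic closure. -/
def GT (Fq : Type) [Field Fq] [Fintype Fq] (ξ : K Fq) (P : Polynomial (Polynomial Fq)) :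
    Polynomial (Kbar Fq) := (FT Fq ξ P).map (algebraMap (K Fq) (Kbar Fq))

theorem GT_eq (Fq : Type) [Field Fq] [Fintype Fq] (ξ : K Fq) (P : Polynomial (Polynomial Fq)) :
    GT Fq ξ P = taylor (algebraMap (K Fq) (Kbar Fq) ξ) (P.map (embbar Fq)) := by
  rw [GT, FT, map_taylor, Polynomial.map_map, embbar]

theorem FT_eval (Fq : Type) [Field Fq] [Fintype Fq] (ξ : K Fq) (P : Polynomial (Polynomial Fq))
    (x : K Fq) : (FT Fq ξ P).eval x = evalK Fq P (x + ξ) := by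
  rw [FT, taylor_eval, eval_map, evalK]

theorem GT_eval (Fq : Type) [Field Fq] [Fintype Fq] (ξ : K Fq) (P : Polynomial (Polynomial Fq))
    (x : Kbar Fq) : (GT Fq ξ P).eval x = evalKbar Fq P (x + algebraMap (K Fq) (Kbar Fq) ξ) := by
  rw [GT_eq, taylor_eval, eval_map, evalKbar]

theorem FT_coeff_zero (Fq : Type) [Field Fq] [Fintype Fq] (ξ : K Fq)
    (P : Polynomial (Polynomial Fq)) : (FT Fq ξ P).coeff 0 = evalK Fq P ξ := by
  rw [coeff_zero_eq_eval_zero, FT_eval, zero_add]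

theorem FT_ne_zero (Fq : Type) [Field Fq] [Fintype Fq] (ξ : K Fq)
    (P : Polynomial (Polynomial Fq)) (hP : P ≠ 0) : FT Fq ξ P ≠ 0 := by
  rw [FT, Ne, taylor_eq_zero, Polynomial.map_eq_zero_iff (emb_inj Fq)]
  exact hP

theorem GT_ne_zero (Fq : Type) [Field Fq] [Fintype Fq] (ξ : K Fq)
    (P : Polynomial (Polynomial Fq)) (hP : P ≠ 0) : GT Fq ξ P ≠ 0 := by
  rw [GT_eq, Ne, taylor_eq_zero, Polynomial.map_eq_zero_iff (embbar_inj Fq)]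
  exact hP

theorem GT_natDegree (Fq : Type) [Field Fq] [Fintype Fq] (ξ : K Fq)
    (P : Polynomial (Polynomial Fq)) : (GT Fq ξ P).natDegree = P.natDegree := by
  rw [GT_eq, natDegree_taylor, natDegree_map_eq_of_injective (embbar_inj Fq)]

theorem GT_lc (Fq : Type) [Field Fq] [Fintype Fq] (ξ : K Fq)
    (P : Polynomial (Polynomial Fq)) : (GT Fq ξ P).leadingCoeff = embbar Fq P.leadingCoeff := by
  rw [GT_eq, leadingCoeff_taylor, leadingCoeff_map_of_injective (embbar_inj Fq)]

theorem GT_gauss (Fq : Type) [Field Fq] [Fintype Fq] (ξ : K Fq) (n : ℕ)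
    (P : Polynomial (Polynomial Fq)) (hP : P ≠ 0) (hd : P.natDegree ≤ n) :
    (GT Fq ξ P).gaussNorm (vC Fq) 1 ≤ (max 1 (absK Fq ξ)) ^ n * HP Fq P := by
  apply gauss_le_of_coeff
  intro i
  rw [one_pow, mul_one, GT_eq, taylor_coeff]
  have hd' : (P.map (embbar Fq)).natDegree ≤ n := by
    rwa [natDegree_map_eq_of_injective (embbar_inj Fq)]
  refine (eval_le_gauss_one (vC Fq) (vC_na Fq) _ n
    ((natDegree_hasseDeriv_le _ _).trans ((Nat.sub_le _ _).trans hd')) _).trans ?_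
  rw [vC_alg, mul_comm]
  gcongr
  apply gauss_le_of_coeff
  intro j
  rw [one_pow, mul_one, hasseDeriv_coeff, map_mul, HP_gauss Fq P hP]
  have h1 : vC Fq (((j + i).choose i : ℕ) : Kbar Fq) ≤ 1 := (vC_na Fq).apply_natCast_le_one
  have h2 := Polynomial.le_gaussNorm (vC Fq) (P.map (embbar Fq)) zero_le_one (j + i)
  rw [one_pow, mul_one] at h2
  calc _ ≤ 1 * vC Fq ((P.map (embbar Fq)).coeff (j + i)) := by
        gcongr
    _ ≤ _ := by rw [one_mul]; exact h2

theorem res_lower (Fq : Type) [Field Fq] [Fintype Fq] (ξ : K Fq)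
    (P Q : Polynomial (Polynomial Fq)) (hP : P ≠ 0) (m : ℕ) (hm : Q.natDegree ≤ m)
    (hcop : ∀ x : Kbar Fq, evalKbar Fq P x = 0 → evalKbar Fq Q x ≠ 0) :
    1 ≤ vC Fq (GT Fq ξ P).leadingCoeff ^ m *
      ((GT Fq ξ P).roots.map (fun s => vC Fq ((GT Fq ξ Q).eval s))).prod := by
  have hlc : 1 ≤ vC Fq (GT Fq ξ P).leadingCoeff := by
    rw [GT_lc]; exact one_le_vC_embbar Fq _ (leadingCoeff_ne_zero.mpr hP)
  have hG0 := GT_ne_zero Fq ξ P hP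
  have key : embbar Fq (P.resultant Q) = (GT Fq ξ P).leadingCoeff ^ Q.natDegree *
      ((GT Fq ξ P).roots.map (fun s => (GT Fq ξ Q).eval s)).prod := by
    have h := resultant_eq_prod_eval (GT Fq ξ P) (GT Fq ξ Q) Q.natDegree
      (GT_natDegree Fq ξ Q).le (IsAlgClosed.splits _)
    rw [← h, ← resultant_map_map]
    have h2 := resultant_taylor (P.map (embbar Fq)) (Q.map (embbar Fq))
      (algebraMap (K Fq) (Kbar Fq) ξ)
    rw [natDegree_taylor, natDegree_taylor, natDegree_map_eq_of_injective (embbar_inj Fq),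
      natDegree_map_eq_of_injective (embbar_inj Fq)] at h2
    rw [← h2, GT_natDegree, GT_eq, GT_eq]
  have hne : embbar Fq (P.resultant Q) ≠ 0 := by
    rw [key]
    apply mul_ne_zero
    · exact pow_ne_zero _ (leadingCoeff_ne_zero.mpr hG0)
    · rw [Ne, Multiset.prod_eq_zero_iff, Multiset.mem_map]
      rintro ⟨s, hs, hs0⟩
      rw [mem_roots hG0, IsRoot.def, GT_eval] at hs
      rw [GT_eval] at hs0
      exact hcop _ hs hs0
  have h1 : 1 ≤ vC Fq (embbar Fq (P.resultant Q)) := by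
    apply one_le_vC_embbar
    intro h; rw [h, map_zero] at hne; exact hne rfl
  rw [key, map_mul, map_pow, map_multiset_prod, Multiset.map_map] at h1
  refine h1.trans ?_
  have hp : 0 ≤ ((GT Fq ξ P).roots.map (fun s => vC Fq ((GT Fq ξ Q).eval s))).prod := by
    apply Multiset.prod_nonneg
    intro x hx
    obtain ⟨y, _, rfl⟩ := Multiset.mem_map.mp hx
    exact (vC Fq).nonneg _
  exact mul_le_mul_of_nonneg_right (pow_le_pow_right₀ hlc hm) hp

end arith

section counting

theorem absK_mul (Fq : Type) [Field Fq] [Fintype Fq] (x y : K Fq) :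
    absK Fq (x * y) = absK Fq x * absK Fq y := by
  rw [← vC_alg, ← vC_alg, ← vC_alg, map_mul, map_mul]

theorem absK_pow (Fq : Type) [Field Fq] [Fintype Fq] (x : K Fq) (n : ℕ) :
    absK Fq (x ^ n) = absK Fq x ^ n := by
  rw [← vC_alg, ← vC_alg, map_pow, map_pow]

theorem absK_nonneg (Fq : Type) [Field Fq] [Fintype Fq] (x : K Fq) : 0 ≤ absK Fq x := by
  rw [← vC_alg]; exact (vC Fq).nonneg _

theorem absK_pos (Fq : Type) [Field Fq] [Fintype Fq] (x : K Fq) (hx : x ≠ 0) : 0 < absK Fq x := by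
  rw [← vC_alg]; exact (vC Fq).pos (by simpa using hx)

theorem absK_pos_iff (Fq : Type) [Field Fq] [Fintype Fq] (x : K Fq) : 0 < absK Fq x ↔ x ≠ 0 := by
  refine ⟨?_, absK_pos Fq x⟩
  rintro h rfl
  rw [absK, if_pos rfl] at h
  exact lt_irrefl _ h

theorem HP_coeff (Fq : Type) [Field Fq] [Fintype Fq] (P : Polynomial (Polynomial Fq)) (N : ℕ) :
    HP Fq P ≤ (Fintype.card Fq : ℝ) ^ N ↔ ∀ i, (P.coeff i).natDegree ≤ N := by
  rw [HP, pow_le_pow_iff_right₀ (card_gt_one Fq), Finset.sup_le_iff]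
  constructor
  · intro h i
    by_cases hi : i ∈ P.support
    · exact h i hi
    · rw [notMem_support_iff.mp hi]; simp
  · intro h i _
    exact h i

theorem finite_polys (Fq : Type) [Field Fq] [Fintype Fq] (n : ℕ) (B : ℝ) :
    {P : Polynomial (Polynomial Fq) | P.natDegree ≤ n ∧ HP Fq P ≤ B}.Finite := by
  obtain ⟨N, hN⟩ := pow_unbounded_of_one_lt B (card_gt_one Fq)
  let f : Polynomial (Polynomial Fq) → (Fin (n + 1) → Fin (N + 1) → Fq) :=
    fun P i j => (P.coeff i).coeff j
  refine Set.Finite.of_injOn (f := f) (t := Set.univ) (fun _ _ => Set.mem_univ _) ?_ Set.finite_univ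
  rintro P ⟨hP, hPB⟩ Q ⟨hQ, hQB⟩ h
  have hP' := (HP_coeff Fq P N).mp (hPB.trans hN.le)
  have hQ' := (HP_coeff Fq Q N).mp (hQB.trans hN.le)
  ext i j
  by_cases hi : i < n + 1
  · by_cases hj : j < N + 1
    · exact congrFun (congrFun h ⟨i, hi⟩) ⟨j, hj⟩
    · rw [coeff_eq_zero_of_natDegree_lt (by have := hP' i; omega),
        coeff_eq_zero_of_natDegree_lt (by have := hQ' i; omega)]
  · have h1 : P.coeff i = 0 := coeff_eq_zero_of_natDegree_lt (by omega)
    have h2 : Q.coeff i = 0 := coeff_eq_zero_of_natDegree_lt (by omega)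
    rw [h1, h2]

theorem finite_alg (Fq : Type) [Field Fq] [Fintype Fq] (n : ℕ) (B : ℝ) :
    {x : Kbar Fq | IsAlgKbar Fq x ∧ degAbar Fq x ≤ n ∧ HAbar Fq x ≤ B}.Finite := by
  refine ((finite_polys Fq n B).biUnion
    (t := fun P => {x : Kbar Fq | P ≠ 0 ∧ evalKbar Fq P x = 0}) ?_).subset ?_
  · intro P _
    by_cases hP : P = 0
    · simp [hP]
    · refine (Polynomial.finite_setOfPred_isRoot (p := P.map (embbar Fq)) ?_).subset ?_
      · rwa [Ne, Polynomial.map_eq_zero_iff (embbar_inj Fq)]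
      · rintro x ⟨_, hx⟩
        simpa [IsRoot.def, eval_map, evalKbar] using hx
  · rintro x ⟨hx, hd, hH⟩
    obtain ⟨P, hP, _, hPx, h1, h2⟩ := alg_data Fq x hx
    simp only [Set.mem_iUnion]
    exact ⟨P, ⟨h1 ▸ hd, h2 ▸ hH⟩, hP.ne_zero, hPx⟩

theorem exists_large (Fq : Type) [Field Fq] [Fintype Fq] (n : ℕ) (B : ℝ) (S : Set (Kbar Fq))
    (hS : S.Infinite) (hS' : ∀ x ∈ S, IsAlgKbar Fq x ∧ degAbar Fq x ≤ n) :
    ∃ x ∈ S, B < HAbar Fq x := by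
  by_contra h
  push Not at h
  exact hS ((finite_alg Fq n B).subset fun x hx => ⟨(hS' x hx).1, (hS' x hx).2, h x hx⟩)

theorem absK_le_of_coeff (Fq : Type) [Field Fq] [Fintype Fq] (y : K Fq) (k : ℤ)
    (h : ∀ j < k, y.coeff j = 0) : absK Fq y ≤ (Fintype.card Fq : ℝ) ^ (-k) := by
  have := card_gt_one Fq
  by_cases hy : y = 0
  · rw [absK, if_pos hy]; positivity
  · rw [absK, if_neg hy]
    apply zpow_le_zpow_right₀ this.le
    rw [neg_le_neg_iff, HahnSeries.le_order_iff_forall hy]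
    exact h

theorem coeff_of_absK_le (Fq : Type) [Field Fq] [Fintype Fq] (y : K Fq) (k : ℤ)
    (h : absK Fq y ≤ (Fintype.card Fq : ℝ) ^ (-k)) (j : ℤ) (hj : j < k) : y.coeff j = 0 := by
  by_cases hy : y = 0
  · rw [hy]; rfl
  · rw [absK, if_neg hy, zpow_le_zpow_iff_right₀ (card_gt_one Fq)] at h
    apply HahnSeries.coeff_eq_zero_of_lt_order
    omega

theorem evalK_mono_coeff (Fq : Type) [Field Fq] [Fintype Fq] (ξ : K Fq) (i j : ℕ) (c : Fq) (k : ℤ) :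
    (evalK Fq (monomial i (monomial j c)) ξ).coeff k = (emb Fq (X ^ j) * ξ ^ i).coeff k * c := by
  rw [evalK, eval₂_monomial, ← C_mul_X_pow_eq_monomial, map_mul, mul_assoc]
  have : emb Fq (C c) = HahnSeries.C c := by
    rw [emb, coe_eval₂RingHom, eval₂_C, algKC, HahnSeries.C_apply]
  rw [this, HahnSeries.C_mul_eq_smul, HahnSeries.coeff_smul, smul_eq_mul, mul_comm]

theorem dirichlet (Fq : Type) [Field Fq] [Fintype Fq] (ξ : K Fq) (m : ℕ) :
    ∃ C : ℝ, 1 ≤ C ∧ ∀ N : ℕ, ∃ Q : Polynomial (Polynomial Fq), Q ≠ 0 ∧ Q.natDegree ≤ m ∧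
      HP Fq Q ≤ (Fintype.card Fq : ℝ) ^ N ∧
      absK Fq (evalK Fq Q ξ) * ((Fintype.card Fq : ℝ) ^ N) ^ m ≤ C := by
  have hq := card_gt_one Fq
  have hq0 : (0 : ℝ) < Fintype.card Fq := by linarith
  obtain ⟨D, hD⟩ := pow_unbounded_of_one_lt (absK Fq ξ) hq
  refine ⟨(Fintype.card Fq : ℝ) ^ (m * D), one_le_pow₀ hq.le, ?_⟩
  intro N
  let E : ℕ := m * N + N + m
  let M : Matrix (Fin E) (Fin (m + 1) × Fin (N + 1)) Fq := fun e x =>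
    (emb Fq (X ^ (x.2 : ℕ)) * ξ ^ (x.1 : ℕ)).coeff ((e : ℤ) - (N + m * D : ℕ))
  have hker : LinearMap.ker M.mulVecLin ≠ ⊥ := by
    apply LinearMap.ker_ne_bot_of_finrank_lt
    simp only [Module.finrank_fintype_fun_eq_card, Fintype.card_prod, Fintype.card_fin]
    have : (m + 1) * (N + 1) = E + 1 := by simp only [E]; ring
    omega
  obtain ⟨c, hc, hc0⟩ := Submodule.exists_mem_ne_zero_of_ne_bot hker
  rw [LinearMap.mem_ker, Matrix.mulVecLin_apply] at hc
  set Q : Polynomial (Polynomial Fq) := ∑ x : Fin (m + 1) × Fin (N + 1),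
    monomial (x.1 : ℕ) (monomial (x.2 : ℕ) (c x)) with hQ
  have hcoeff : ∀ k : ℤ, (evalK Fq Q ξ).coeff k = ∑ x : Fin (m + 1) × Fin (N + 1),
      (emb Fq (X ^ (x.2 : ℕ)) * ξ ^ (x.1 : ℕ)).coeff k * c x := by
    intro k
    have : evalK Fq Q ξ = ∑ x : Fin (m + 1) × Fin (N + 1),
        evalK Fq (monomial (x.1 : ℕ) (monomial (x.2 : ℕ) (c x))) ξ := by
      simp only [evalK, hQ]
      exact eval₂_finsetSum _ _ _ _
    rw [this, HahnSeries.coeff_sum]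
    exact Finset.sum_congr rfl fun x _ => evalK_mono_coeff Fq ξ _ _ _ _
  refine ⟨Q, ?_, ?_, ?_, ?_⟩
  · intro h0
    apply hc0
    funext x
    have h1 : (Q.coeff x.1).coeff x.2 = c x := by
      rw [hQ, finsetSum_coeff, finsetSum_coeff, Finset.sum_eq_single x]
      · simp
      · intro y _ hy
        rw [coeff_monomial]
        split_ifs with h
        · rw [coeff_monomial, if_neg]
          intro h'
          exact hy (Prod.ext (Fin.ext h) (Fin.ext h'))
        · simp
      · simp
    rw [← h1, h0]; simp
  · apply natDegree_sum_le_of_forall_le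
    intro x _
    exact (natDegree_monomial_le _).trans (by omega)
  · rw [HP_coeff]
    intro i
    rw [hQ, finsetSum_coeff]
    apply natDegree_sum_le_of_forall_le
    intro x _
    rw [coeff_monomial]
    split_ifs
    · exact (natDegree_monomial_le _).trans (by omega)
    · simp
  · have hlow : ∀ k : ℤ, k < -(N + m * D : ℕ) → (evalK Fq Q ξ).coeff k = 0 := by
      intro k hk
      rw [hcoeff]
      apply Finset.sum_eq_zero
      intro x _
      rw [coeff_of_absK_le Fq _ _ _ k hk, zero_mul]
      rw [neg_neg, zpow_natCast, absK_mul, absK_pow, absK_emb Fq _ (by simp), natDegree_X_pow,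
        pow_add, mul_comm m D, pow_mul]
      have h1 : absK Fq ξ ^ (x.1 : ℕ) ≤ ((Fintype.card Fq : ℝ) ^ D) ^ m := by
        have h3 : (1 : ℝ) ≤ (Fintype.card Fq : ℝ) ^ D := one_le_pow₀ hq.le
        calc absK Fq ξ ^ (x.1 : ℕ) ≤ ((Fintype.card Fq : ℝ) ^ D) ^ (x.1 : ℕ) :=
              pow_le_pow_left₀ (absK_nonneg Fq ξ) hD.le _
          _ ≤ _ := pow_le_pow_right₀ h3 (by omega)
      have h2 : (Fintype.card Fq : ℝ) ^ (x.2 : ℕ) ≤ (Fintype.card Fq : ℝ) ^ N :=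
        pow_le_pow_right₀ hq.le (by omega)
      exact mul_le_mul h2 h1 (pow_nonneg (absK_nonneg Fq ξ) _) (by positivity)
    have hall : absK Fq (evalK Fq Q ξ) ≤ (Fintype.card Fq : ℝ) ^ (-((E : ℤ) - (N + m * D : ℕ))) := by
      apply absK_le_of_coeff
      intro k hk
      by_cases hk' : k < -(N + m * D : ℕ)
      · exact hlow k hk'
      · obtain ⟨e, he⟩ : ∃ e : ℕ, k = (e : ℤ) - (N + m * D : ℕ) :=
          ⟨(k + (N + m * D : ℕ)).toNat, by omega⟩
        have heE : e < E := by omega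
        have := congrFun hc ⟨e, heE⟩
        rw [hcoeff, he]
        simpa [Matrix.mulVec, dotProduct, M] using this
    calc absK Fq (evalK Fq Q ξ) * ((Fintype.card Fq : ℝ) ^ N) ^ m
        ≤ (Fintype.card Fq : ℝ) ^ (-((E : ℤ) - (N + m * D : ℕ))) * ((Fintype.card Fq : ℝ) ^ N) ^ m := by
          gcongr
      _ = (Fintype.card Fq : ℝ) ^ (-((E : ℤ) - (N + m * D : ℕ)) + (N * m : ℕ)) := by
          rw [zpow_add₀ hq0.ne', zpow_natCast, pow_mul]
      _ ≤ (Fintype.card Fq : ℝ) ^ ((m * D : ℕ) : ℤ) := by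
          apply zpow_le_zpow_right₀ hq.le
          simp only [E]
          push_cast
          nlinarith
      _ = _ := by rw [zpow_natCast]

theorem const_ge (Fq : Type) [Field Fq] [Fintype Fq] (ξ : K Fq) (e : ℝ) (he : 0 ≤ e)
    (R : Polynomial (Polynomial Fq)) (hR : R ≠ 0) (h : R.natDegree = 0) :
    1 ≤ absK Fq (evalK Fq R ξ) * HP Fq R ^ e := by
  obtain ⟨c, rfl⟩ := natDegree_eq_zero.mp h
  have hc : c ≠ 0 := by rintro rfl; simp at hR
  rw [evalK, eval₂_C, absK_emb Fq c hc]
  have h1 : (1 : ℝ) ≤ (Fintype.card Fq : ℝ) ^ c.natDegree := one_le_pow₀ (card_gt_one Fq).le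
  have h2 : 1 ≤ HP Fq (C c) ^ e := Real.one_le_rpow (HP_ge_one Fq _) he
  nlinarith

theorem factor_lemma (Fq : Type) [Field Fq] [Fintype Fq] (ξ : K Fq) (e τ : ℝ) (he : 0 ≤ e)
    (hτ : 0 < τ) (hτ1 : τ ≤ 1) (R : Polynomial (Polynomial Fq)) : R ≠ 0 →
    (∀ P, Irreducible P → P ∣ R → 0 < P.natDegree → τ ≤ absK Fq (evalK Fq P ξ) * HP Fq P ^ e) →
    τ ^ R.natDegree ≤ absK Fq (evalK Fq R ξ) * HP Fq R ^ e := by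
  induction R using WfDvdMonoid.induction_on_irreducible with
  | zero => intro h; exact absurd rfl h
  | unit u hu =>
    intro hu0 _
    have h0 : u.natDegree = 0 := natDegree_eq_zero_of_isUnit hu
    rw [h0, pow_zero]
    exact const_ge Fq ξ e he u hu0 h0
  | mul a i ha hi ih =>
    intro h0 hP
    have ih' := ih ha fun P h1 h2 h3 => hP P h1 (h2.mul_left _) h3
    have hstep : τ ^ i.natDegree ≤ absK Fq (evalK Fq i ξ) * HP Fq i ^ e := by
      by_cases hd : i.natDegree = 0
      · rw [hd, pow_zero]
        exact const_ge Fq ξ e he i hi.ne_zero hd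
      · refine le_trans ?_ (hP i hi (dvd_mul_right _ _) (Nat.pos_of_ne_zero hd))
        exact pow_le_of_le_one hτ.le hτ1 hd
    rw [natDegree_mul hi.ne_zero ha, pow_add, HP_mul Fq _ _ hi.ne_zero ha,
      Real.mul_rpow (zero_le_one.trans (HP_ge_one Fq i)) (zero_le_one.trans (HP_ge_one Fq a))]
    have : evalK Fq (i * a) ξ = evalK Fq i ξ * evalK Fq a ξ := by
      simp only [evalK, eval₂_mul]
    rw [this, absK_mul]
    calc _ ≤ (absK Fq (evalK Fq i ξ) * HP Fq i ^ e) * (absK Fq (evalK Fq a ξ) * HP Fq a ^ e) := by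
          exact mul_le_mul hstep ih' (by positivity) ((pow_nonneg hτ.le _).trans hstep)
      _ = _ := by ring

theorem exists_irred (Fq : Type) [Field Fq] [Fintype Fq] (ξ : K Fq) (m : ℕ)
    (hξ : ∀ P : Polynomial (Polynomial Fq), P ≠ 0 → P.natDegree ≤ m → evalK Fq P ξ ≠ 0)
    (ε : ℝ) (hε : 0 < ε) (hεm : ε ≤ m) (B : ℝ) :
    ∃ P : Polynomial (Polynomial Fq), Irreducible P ∧ 0 < P.natDegree ∧ P.natDegree ≤ m ∧
      B < HP Fq P ∧ absK Fq (evalK Fq P ξ) * HP Fq P ^ ((m : ℝ) - ε) < 1 := by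
  have hq := card_gt_one Fq
  have hq0 : (0 : ℝ) < Fintype.card Fq := by linarith
  -- a threshold for the finitely many small polynomials
  obtain ⟨τ, hτ, hτ1, hτB⟩ : ∃ τ : ℝ, 0 < τ ∧ τ ≤ 1 ∧ ∀ P : Polynomial (Polynomial Fq), P ≠ 0 →
      P.natDegree ≤ m → HP Fq P ≤ B → τ ≤ absK Fq (evalK Fq P ξ) * HP Fq P ^ ((m : ℝ) - ε) := by
    have hfin := finite_polys Fq m B
    let S := hfin.toFinset.filter (fun P => P ≠ 0)
    let f : Polynomial (Polynomial Fq) → ℝ := fun P => absK Fq (evalK Fq P ξ) * HP Fq P ^ ((m : ℝ) - ε)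
    have hpos : ∀ P ∈ S, 0 < f P := by
      intro P hP
      simp only [S, Finset.mem_filter, Set.Finite.mem_toFinset, Set.mem_ofPred_eq] at hP
      exact mul_pos (absK_pos Fq _ (hξ P hP.2 hP.1.1))
        (Real.rpow_pos_of_pos (zero_lt_one.trans_le (HP_ge_one Fq P)) _)
    by_cases hS : S.Nonempty
    · refine ⟨min 1 (S.inf' hS f), ?_, min_le_left _ _, ?_⟩
      · apply lt_min one_pos
        rw [Finset.lt_inf'_iff]
        exact hpos
      · intro P h0 h1 h2
        refine (min_le_right _ _).trans (Finset.inf'_le f ?_)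
        simp only [S, Finset.mem_filter, Set.Finite.mem_toFinset, Set.mem_ofPred_eq]
        exact ⟨⟨h1, h2⟩, h0⟩
    · refine ⟨1, one_pos, le_rfl, ?_⟩
      intro P h0 h1 h2
      exfalso
      apply hS
      refine ⟨P, ?_⟩
      simp only [S, Finset.mem_filter, Set.Finite.mem_toFinset, Set.mem_ofPred_eq]
      exact ⟨⟨h1, h2⟩, h0⟩
  obtain ⟨C, hC, hdir⟩ := dirichlet Fq ξ m
  -- choose N with C q^{-εN} < τ^m
  obtain ⟨N, hN⟩ : ∃ N : ℕ, C / τ ^ m < ((Fintype.card Fq : ℝ) ^ ε) ^ N :=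
    pow_unbounded_of_one_lt _ (Real.one_lt_rpow hq hε)
  obtain ⟨R, hR, hRd, hRH, hRξ⟩ := hdir N
  have hsmall : absK Fq (evalK Fq R ξ) * HP Fq R ^ ((m : ℝ) - ε) < τ ^ m := by
    set x : ℝ := (Fintype.card Fq : ℝ) ^ N with hx
    have hx0 : 0 < x := by positivity
    have h1 : HP Fq R ^ ((m : ℝ) - ε) ≤ x ^ ((m : ℝ) - ε) :=
      Real.rpow_le_rpow (zero_le_one.trans (HP_ge_one Fq R)) hRH (by linarith)
    have h2 : x ^ ((m : ℝ) - ε) = x ^ m / x ^ ε := by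
      rw [Real.rpow_sub hx0, Real.rpow_natCast]
    have h3 : ((Fintype.card Fq : ℝ) ^ ε) ^ N = x ^ ε := by
      rw [hx, ← Real.rpow_natCast, ← Real.rpow_natCast, ← Real.rpow_mul hq0.le,
        ← Real.rpow_mul hq0.le, mul_comm]
    rw [h3, div_lt_iff₀ (by positivity)] at hN
    have h4 : 0 < x ^ ε := Real.rpow_pos_of_pos hx0 _
    calc _ ≤ absK Fq (evalK Fq R ξ) * (x ^ m / x ^ ε) := by
          rw [← h2]; exact mul_le_mul_of_nonneg_left h1 (absK_nonneg Fq _)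
      _ = (absK Fq (evalK Fq R ξ) * x ^ m) / x ^ ε := by ring
      _ ≤ C / x ^ ε := by gcongr
      _ < τ ^ m := by rw [div_lt_iff₀ h4]; linarith
  have hex : ∃ P, Irreducible P ∧ P ∣ R ∧ 0 < P.natDegree ∧
      absK Fq (evalK Fq P ξ) * HP Fq P ^ ((m : ℝ) - ε) < τ := by
    by_contra hcon
    push Not at hcon
    have := factor_lemma Fq ξ ((m : ℝ) - ε) τ (by linarith) hτ hτ1 R hR hcon
    have h2 : τ ^ m ≤ τ ^ R.natDegree := pow_le_pow_of_le_one hτ.le hτ1 hRd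
    linarith
  obtain ⟨P, hP, hPR, hPd, hPτ⟩ := hex
  have hPm := (natDegree_le_of_dvd hPR hR).trans hRd
  refine ⟨P, hP, hPd, hPm, ?_, hPτ.trans_le hτ1⟩
  by_contra hB
  exact absurd (hτB P hP.ne_zero hPm (not_lt.mp hB)) (not_le.mpr hPτ)

end counting

section final

theorem large_rpow (e : ℝ) (he : 0 < e) (A : ℝ) : ∃ B : ℝ, ∀ H : ℝ, B < H → A < H ^ e := by
  have := (tendsto_rpow_atTop he).eventually_gt_atTop A
  rw [Filter.eventually_atTop] at this
  obtain ⟨B, hB⟩ := this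
  exact ⟨B, fun H hH => hB H hH.le⟩

theorem dir2 (Fq : Type) [Field Fq] [Fintype Fq] (ξ : K Fq) (m : ℕ) :
    ∃ C : ℝ, 1 ≤ C ∧ ∀ P : Polynomial (Polynomial Fq), 1 < HP Fq P →
      ∃ Q : Polynomial (Polynomial Fq), Q ≠ 0 ∧ Q.natDegree ≤ m ∧
      HP Fq Q < HP Fq P ∧ absK Fq (evalK Fq Q ξ) * HP Fq P ^ m ≤ C := by
  have hq := card_gt_one Fq
  obtain ⟨C, hC, h⟩ := dirichlet Fq ξ m
  have hqm : (1 : ℝ) ≤ (Fintype.card Fq : ℝ) ^ m := one_le_pow₀ hq.le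
  refine ⟨C * (Fintype.card Fq : ℝ) ^ m, by nlinarith, ?_⟩
  intro P hP
  obtain ⟨s, hs⟩ : ∃ s : ℕ, HP Fq P = (Fintype.card Fq : ℝ) ^ s := ⟨_, rfl⟩
  have hs0 : s ≠ 0 := by rintro rfl; rw [hs, pow_zero] at hP; exact lt_irrefl _ hP
  obtain ⟨N, rfl⟩ := Nat.exists_eq_succ_of_ne_zero hs0
  obtain ⟨Q, h1, h2, h3, h4⟩ := h N
  refine ⟨Q, h1, h2, h3.trans_lt ?_, ?_⟩
  · rw [hs]; exact pow_lt_pow_right₀ hq (Nat.lt_succ_self N)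
  · rw [hs, pow_succ, mul_pow, ← mul_assoc]
    gcongr

theorem no_root (Fq : Type) [Field Fq] [Fintype Fq] (ξ : K Fq) (n : ℕ) (w : ℝ)
    (hw : w ∉ wnstarSet Fq ξ n) (hw1 : -1 ≤ w) :
    ∃ ρ : ℝ, 0 < ρ ∧ ∀ Q : Polynomial (Polynomial Fq), Q ≠ 0 → Q.natDegree ≤ n →
      evalK Fq Q ξ ≠ 0 → ∀ H : ℝ, HP Fq Q ≤ H → ∀ r : ℝ, r ≤ ρ → r ≤ H ^ (-w - 1) →
      ∀ x : K Fq, (FT Fq ξ Q).eval x = 0 → r ≤ vC Fq (algebraMap (K Fq) (Kbar Fq) x) := by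
  set S := {α : K Fq | IsAlgK Fq α ∧ degA Fq α ≤ n ∧ 0 < absK Fq (ξ - α) ∧
      absK Fq (ξ - α) < HA Fq α ^ (-w - 1)} with hS
  have hfin : S.Finite := by
    by_contra h
    exact hw h
  obtain ⟨ρ, hρ, hρS⟩ : ∃ ρ : ℝ, 0 < ρ ∧ ∀ α ∈ S, ρ ≤ absK Fq (ξ - α) := by
    by_cases hne : hfin.toFinset.Nonempty
    · refine ⟨hfin.toFinset.inf' hne (fun α => absK Fq (ξ - α)), ?_, ?_⟩
      · rw [Finset.lt_inf'_iff]
        intro α hα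
        rw [Set.Finite.mem_toFinset] at hα
        exact hα.2.2.1
      · intro α hα
        exact Finset.inf'_le (fun α => absK Fq (ξ - α)) (hfin.mem_toFinset.mpr hα)
    · refine ⟨1, one_pos, ?_⟩
      intro α hα
      exact absurd ⟨α, hfin.mem_toFinset.mpr hα⟩ hne
  refine ⟨ρ, hρ, ?_⟩
  intro Q hQ hQd hQξ H hH r hr hrH x hx
  rw [FT_eval] at hx
  by_contra hlt
  rw [not_le, vC_alg] at hlt
  have habs : absK Fq (ξ - (x + ξ)) = absK Fq x := by
    rw [← vC_alg, ← vC_alg, sub_add_cancel_right, map_neg, AbsoluteValue.map_neg]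
  have hx0 : x ≠ 0 := by
    rintro rfl
    rw [zero_add] at hx
    exact hQξ hx
  have hxbar := (evalKbar_alg_zero Fq Q (x + ξ)).mpr hx
  obtain ⟨hd, hh⟩ := HAbar_le Fq _ Q hQ hxbar
  have h1 := HAbar_ge_one Fq (algebraMap (K Fq) (Kbar Fq) (x + ξ)) ⟨Q, hQ, hxbar⟩
  rw [degAbar_alg] at hd
  rw [HAbar_alg] at hh h1
  have hmem : x + ξ ∈ S := by
    refine ⟨⟨Q, hQ, hx⟩, hd.trans hQd, ?_, ?_⟩
    · rw [habs]; exact absK_pos Fq x hx0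
    · rw [habs]
      refine hlt.trans_le (hrH.trans ?_)
      exact Real.rpow_le_rpow_of_nonpos (by linarith) (hh.trans hH) (by linarith)
  have := hρS _ hmem
  rw [habs] at this
  linarith

theorem le_wnstar (Fq : Type) [Field Fq] [Fintype Fq] (ξ : K Fq) (n : ℕ) (w : ℝ)
    (hw : w ∈ wnstarSet Fq ξ n) : (w : EReal) ≤ wnstar Fq ξ n :=
  le_sSup ⟨w, hw, rfl⟩

theorem lemmaW (Fq : Type) [Field Fq] [Fintype Fq] (ξ : K Fq) (n m : ℕ) (hm : 1 ≤ m) (hmn : m ≤ n)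
    (hξ : ∀ P : Polynomial (Polynomial Fq), P ≠ 0 → P.natDegree ≤ m → evalK Fq P ξ ≠ 0) :
    ((((m : ℝ) - 1) / 2 : ℝ) : EReal) ≤ wnstar Fq ξ n := by
  apply le_wnstar
  by_contra hw
  have hm1 : (1 : ℝ) ≤ m := by exact_mod_cast hm
  obtain ⟨ρ, hρ, hnr⟩ := no_root Fq ξ n _ hw (by linarith)
  obtain ⟨C2, hC2, hdir⟩ := dir2 Fq ξ m
  set C1 : ℝ := (max 1 (absK Fq ξ)) ^ m with hC1
  have hC11 : 1 ≤ C1 := one_le_pow₀ (le_max_left _ _)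
  set A0 : ℝ := C1 * C2 with hA0
  have hA1 : C1 ≤ A0 := by nlinarith
  have hA2 : C2 ≤ A0 := by nlinarith
  have hA01 : 1 ≤ A0 := hC11.trans hA1
  set ε : ℝ := 1 / (2 * m + 2) with hε
  have hε0 : 0 < ε := by positivity
  have hεm : ε ≤ m := by
    rw [hε, div_le_iff₀ (by positivity)]; nlinarith
  set M : ℝ := ((m : ℝ) + 1) / 2 with hM
  have hM0 : 0 < M := by positivity
  obtain ⟨B1, hB1⟩ := large_rpow ε hε0 (A0 ^ (2 * m + 1))
  obtain ⟨B2, hB2⟩ := large_rpow M hM0 (1 / ρ)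
  obtain ⟨P, hP, hPd, hPm, hPB, hPξ⟩ := exists_irred Fq ξ m hξ ε hε0 hεm (max 1 (max B1 B2))
  set H := HP Fq P with hH
  have hH1 : 1 < H := (le_max_left _ _).trans_lt hPB
  have hH0 : 0 < H := by linarith
  have hb1 := hB1 H (((le_max_left _ _).trans (le_max_right _ _)).trans_lt hPB)
  have hb2 := hB2 H (((le_max_right _ _).trans (le_max_right _ _)).trans_lt hPB)
  obtain ⟨Q, hQ, hQm, hQH, hQξ⟩ := hdir P hH1
  rw [← hH] at hQH hQξ
  set r : ℝ := H ^ (-M) with hr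
  have hr0 : 0 < r := Real.rpow_pos_of_pos hH0 _
  have hr1 : r ≤ 1 := Real.rpow_le_one_of_one_le_of_nonpos hH1.le (by linarith)
  have hrρ : r ≤ ρ := by
    rw [hr, Real.rpow_neg hH0.le]
    rw [div_lt_iff₀ hρ] at hb2
    rw [inv_le_iff_one_le_mul₀ (Real.rpow_pos_of_pos hH0 _)]
    linarith
  have hrM : r ≤ H ^ (-(((m : ℝ) - 1) / 2) - 1) := by
    apply le_of_eq
    rw [hr, hM]; congr 1; ring
  have hr2 : r ^ 2 = H ^ (-((m : ℝ) + 1)) := by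
    rw [hr, ← Real.rpow_natCast, ← Real.rpow_mul hH0.le]
    congr 1; rw [hM]; push_cast; ring
  set A : ℝ := A0 * H ^ (1 + ε) with hA
  have hHe : H ≤ H ^ (1 + ε) := by
    conv_lhs => rw [← Real.rpow_one H]
    exact Real.rpow_le_rpow_of_exponent_le hH1.le (by linarith)
  have hA1' : 1 ≤ A := by nlinarith
  have hAr : A * r ^ 2 = A0 * H ^ (ε - m) := by
    rw [hA, hr2, mul_assoc, ← Real.rpow_add hH0]; congr 2; ring
  have gP1 : (GT Fq ξ P).gaussNorm (vC Fq) 1 ≤ A := by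
    refine (GT_gauss Fq ξ m P hP.ne_zero hPm).trans ?_
    rw [← hC1, ← hH, hA]
    gcongr
  have gQ1 : (GT Fq ξ Q).gaussNorm (vC Fq) 1 ≤ A := by
    refine (GT_gauss Fq ξ m Q hQ hQm).trans ?_
    rw [← hC1]
    calc C1 * HP Fq Q ≤ C1 * H := by gcongr
      _ ≤ A := by rw [hA]; gcongr
  have gPr : (GT Fq ξ P).gaussNorm (vC Fq) r ≤ A * r ^ 2 := by
    refine (lemmaA (vC Fq) (vC_na Fq) (vC_minpoly Fq) (FT Fq ξ P) (FT_ne_zero Fq ξ P hP.ne_zero) r hr0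
      hr1 (hnr P hP.ne_zero (hPm.trans hmn) (hξ P hP.ne_zero hPm) H le_rfl r hrρ hrM)).trans ?_
    apply max_le
    · rw [vC_alg, FT_coeff_zero, hAr]
      have : ε - (m : ℝ) = -((m : ℝ) - ε) := by ring
      rw [this, Real.rpow_neg hH0.le]
      have h1 : 0 < H ^ ((m : ℝ) - ε) := Real.rpow_pos_of_pos hH0 _
      rw [← div_eq_mul_inv, le_div_iff₀ h1]
      linarith
    · exact mul_le_mul_of_nonneg_right gP1 (by positivity)
  have gQr : (GT Fq ξ Q).gaussNorm (vC Fq) r ≤ A * r ^ 2 := by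
    refine (lemmaA (vC Fq) (vC_na Fq) (vC_minpoly Fq) (FT Fq ξ Q) (FT_ne_zero Fq ξ Q hQ) r hr0
      hr1 (hnr Q hQ (hQm.trans hmn) (hξ Q hQ hQm) H hQH.le r hrρ hrM)).trans ?_
    apply max_le
    · rw [vC_alg, FT_coeff_zero, hAr]
      calc absK Fq (evalK Fq Q ξ) ≤ C2 / H ^ m := by
            rw [le_div_iff₀ (by positivity)]; exact hQξ
        _ ≤ A0 / H ^ m := by gcongr
        _ = A0 * H ^ (-(m : ℝ)) := by rw [Real.rpow_neg hH0.le, Real.rpow_natCast, div_eq_mul_inv]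
        _ ≤ A0 * H ^ (ε - m) := by
            gcongr
            · exact hH1.le
            · linarith
    · exact mul_le_mul_of_nonneg_right gQ1 (by positivity)
  obtain ⟨l, rfl⟩ : ∃ l, m = l + 1 := ⟨m - 1, by omega⟩
  have hlow := res_lower Fq ξ P Q hP.ne_zero (l + 2) (by omega) (by
    intro x hx hx'
    have := HP_dvd Fq P Q hQ (min_dvd Fq P Q hP hPd x hx hx')
    linarith)
  have hup := res_four (vC Fq) (vC_na Fq) (GT Fq ξ P) (GT Fq ξ Q) l
    (by rw [GT_natDegree]; omega) r A hr0 hr1 (by linarith) gP1 gQ1 gPr gQr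
  rw [GT_natDegree] at hup
  have h1 := hlow.trans hup
  have h2 : A ^ P.natDegree ≤ A ^ (l + 1) := pow_le_pow_right₀ hA1' hPm
  have h3 : A ^ P.natDegree * A ^ (l + 2) * r ^ 4 ≤ A ^ (2 * (l + 1) + 1) * r ^ 4 := by
    calc _ ≤ A ^ (l + 1) * A ^ (l + 2) * r ^ 4 := by gcongr
      _ = _ := by ring
  have h4 : A ^ (2 * (l + 1) + 1) * r ^ 4 = A0 ^ (2 * (l + 1) + 1) * H ^ (-ε) := by
    have : r ^ 4 = (r ^ 2) ^ 2 := by ring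
    rw [this, hr2, hA, mul_pow, mul_assoc, ← Real.rpow_natCast, ← Real.rpow_natCast,
      ← Real.rpow_natCast, ← Real.rpow_mul hH0.le, ← Real.rpow_mul hH0.le, ← Real.rpow_add hH0]
    congr 2
    rw [hε]
    push_cast
    field_simp
    ring
  rw [h4] at h3
  have h5 := h1.trans h3
  rw [Real.rpow_neg hH0.le, ← div_eq_mul_inv, le_div_iff₀ (Real.rpow_pos_of_pos hH0 _)] at h5
  linarith

end final

section final2

theorem lin_c0 {R : Type*} [CommRing R] (u v : R) : (C u * X + C v).coeff 0 = v := by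
  simp

theorem lin_c1 {R : Type*} [CommRing R] (u v : R) : (C u * X + C v).coeff 1 = u := by
  rw [coeff_add, coeff_C_mul, coeff_X_one, mul_one, coeff_C, if_neg one_ne_zero, add_zero]

theorem lin_HP (Fq : Type) [Field Fq] [Fintype Fq] (u v : Polynomial Fq) (m : ℕ)
    (hu : u.natDegree ≤ m) (hv : v.natDegree ≤ m) :
    HP Fq (C u * X + C v) ≤ (Fintype.card Fq : ℝ) ^ m := by
  rw [HP_coeff]
  intro i
  rcases i with _ | _ | i
  · rw [lin_c0]; exact hv
  · rw [zero_add, lin_c1]; exact hu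
  · have h : (C u * X + C v).natDegree ≤ 1 := natDegree_linear_le
    rw [coeff_eq_zero_of_natDegree_lt (by omega), natDegree_zero]
    exact Nat.zero_le _

theorem final_id (A0 H : ℝ) (k n : ℕ) (hk : n = k + 2) (hH : 0 < H) :
    (A0 / H ^ n) ^ 2 * (A0 * H) ^ k * (A0 * H) ^ n = A0 ^ (2 * n) / H ^ 2 := by
  subst hk
  have h1 : H ^ (k + 2) ≠ 0 := by positivity
  have h2 : H ^ 2 ≠ 0 := by positivity
  rw [div_pow, mul_pow, mul_pow, div_mul_eq_mul_div, div_mul_eq_mul_div,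
    div_eq_div_iff (pow_ne_zero _ h1) h2]
  ring

theorem lin_eval (Fq : Type) [Field Fq] [Fintype Fq] (u v : Polynomial Fq) (x : K Fq) :
    evalK Fq (C u * X + C v) x = emb Fq u * x + emb Fq v := by
  rw [evalK, eval₂_add, eval₂_mul, eval₂_C, eval₂_C, eval₂_X]

set_option maxHeartbeats 800000 in
theorem step0 (Fq : Type) [Field Fq] [Fintype Fq] (ξ : K Fq) (n : ℕ) (hn : 1 ≤ n)
    (P : Polynomial (Polynomial Fq)) (hP : P ≠ 0) (hd : P.natDegree ≤ 1)
    (hPξ : evalK Fq P ξ = 0) : ((-(1 / 2) : ℝ) : EReal) ≤ wnstar Fq ξ n := by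
  apply le_wnstar
  have hq := card_gt_one Fq
  have hq0 : (0 : ℝ) < Fintype.card Fq := by linarith
  obtain ⟨a, b, rfl⟩ := exists_eq_X_add_C_of_natDegree_le_one hd
  rw [evalK, eval₂_add, eval₂_mul, eval₂_C, eval₂_C, eval₂_X] at hPξ
  have ha : a ≠ 0 := by
    rintro rfl
    rw [map_zero, zero_mul, zero_add, map_eq_zero_iff _ (emb_inj Fq)] at hPξ
    apply hP; rw [hPξ]; simp
  set c := max a.natDegree b.natDegree with hc
  let g : ℕ → K Fq := fun N => ξ + HahnSeries.single ((N + c + 1 : ℕ) : ℤ) (1 : Fq)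
  have hs : ∀ N : ℕ, absK Fq (HahnSeries.single (N : ℤ) (1 : Fq)) = ((Fintype.card Fq : ℝ) ^ N)⁻¹ := by
    intro N
    rw [absK, if_neg (by simp), HahnSeries.order_single one_ne_zero, zpow_neg, zpow_natCast]
  refine Set.infinite_of_injective_forall_mem (f := g) ?_ ?_
  · intro N N' h
    have h1 : HahnSeries.single ((N + c + 1 : ℕ) : ℤ) (1 : Fq) =
        HahnSeries.single ((N' + c + 1 : ℕ) : ℤ) (1 : Fq) := add_left_cancel h
    have h2 := congrArg HahnSeries.order h1
    rw [HahnSeries.order_single one_ne_zero, HahnSeries.order_single one_ne_zero] at h2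
    omega
  · intro N
    set k := N + c + 1 with hk
    obtain ⟨Q, hQ⟩ : ∃ Q : Polynomial (Polynomial Fq),
      Q = C (a * X ^ k) * X + C (b * X ^ k - a) := ⟨_, rfl⟩
    have hQ0 : Q ≠ 0 := by
      intro h
      have h1 := lin_c1 (a * X ^ k) (b * X ^ k - a)
      rw [← hQ, h, coeff_zero] at h1
      have h2 : a * X ^ k ≠ 0 := mul_ne_zero ha (pow_ne_zero _ X_ne_zero)
      exact h2 h1.symm
    have hQd : Q.natDegree ≤ 1 := by rw [hQ]; exact natDegree_linear_le
    have hQH : HP Fq Q ≤ (Fintype.card Fq : ℝ) ^ (k + c) := by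
      rw [hQ]
      apply lin_HP
      · refine natDegree_mul_le.trans ?_
        rw [natDegree_X_pow]; omega
      · refine (natDegree_sub_le _ _).trans (max_le ?_ (by omega))
        refine natDegree_mul_le.trans ?_
        rw [natDegree_X_pow]; omega
    have hTk : emb Fq (X ^ k) * HahnSeries.single (k : ℤ) (1 : Fq) = 1 := by
      rw [← monomial_one_right_eq_X_pow, emb_monomial, HahnSeries.single_mul_single]
      simp
    have hQg : evalK Fq Q (g N) = 0 := by
      have hg : g N = ξ + HahnSeries.single (k : ℤ) (1 : Fq) := rfl
      rw [hQ, lin_eval, hg, map_sub, map_mul, map_mul]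
      linear_combination (emb Fq (X ^ k)) * hPξ + emb Fq a * hTk
    have hQb := (evalKbar_alg_zero Fq Q (g N)).mpr hQg
    obtain ⟨h1, h2⟩ := HAbar_le Fq _ Q hQ0 hQb
    have h3 := HAbar_ge_one Fq _ ⟨Q, hQ0, hQb⟩
    rw [degAbar_alg] at h1
    rw [HAbar_alg] at h2 h3
    have habs : absK Fq (ξ - g N) = ((Fintype.card Fq : ℝ) ^ k)⁻¹ := by
      rw [← hs k, ← vC_alg, ← vC_alg]
      simp only [g]
      rw [← hk, sub_add_cancel_left, map_neg, AbsoluteValue.map_neg]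
    refine ⟨⟨Q, hQ0, hQg⟩, h1.trans (hQd.trans hn), ?_, ?_⟩
    · rw [habs]; positivity
    · rw [habs]
      have e : (-(-(1 / 2)) - 1 : ℝ) = -(1 / 2) := by norm_num
      rw [e, Real.rpow_neg (by linarith)]
      apply inv_strictAnti₀ (Real.rpow_pos_of_pos (by linarith) _)
      calc HA Fq (g N) ^ (1 / 2 : ℝ) ≤ ((Fintype.card Fq : ℝ) ^ (k + c)) ^ (1 / 2 : ℝ) :=
            Real.rpow_le_rpow (by linarith) (h2.trans hQH) (by norm_num)
        _ < (((Fintype.card Fq : ℝ) ^ k) ^ 2) ^ (1 / 2 : ℝ) := by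
            apply Real.rpow_lt_rpow (by positivity) _ (by norm_num)
            rw [← pow_mul]
            exact pow_lt_pow_right₀ hq (by omega)
        _ = (Fintype.card Fq : ℝ) ^ k := by
            rw [← Real.sqrt_eq_rpow, Real.sqrt_sq (by positivity)]

theorem wnstar_le (Fq : Type) [Field Fq] [Fintype Fq] (ξ : K Fq) (n : ℕ) :
    wnstar Fq ξ n ≤ wnAt Fq ξ n := by
  apply sSup_le_sSup
  apply Set.image_mono
  intro w hw
  refine Set.Infinite.mono ?_ (Set.Infinite.image
    ((algebraMap (K Fq) (Kbar Fq)).injective.injOn) hw)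
  rintro _ ⟨α, ⟨h1, h2, h3, h4⟩, rfl⟩
  have e : absC Fq (algebraMap (K Fq) (Kbar Fq) ξ - algebraMap (K Fq) (Kbar Fq) α) =
      absK Fq (ξ - α) := by
    rw [← map_sub, ← vC_eq, vC_alg]
  refine ⟨(isAlg_alg Fq α).mpr h1, ?_, ?_, ?_⟩
  · rw [degAbar_alg]; exact h2
  · rw [e]; exact h3
  · rw [e, HAbar_alg]; exact h4

theorem outside_data (Fq : Type) [Field Fq] [Fintype Fq] (ξ : K Fq)
    (α : Kbar Fq) (hα : ∀ x : K Fq, algebraMap (K Fq) (Kbar Fq) x ≠ α)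
    (P : Polynomial (Polynomial Fq)) (hP : P ≠ 0) (hPα : evalKbar Fq P α = 0) :
    ∃ (s s2 : Kbar Fq) (M : Multiset (Kbar Fq)),
      vC Fq s = absC Fq (algebraMap (K Fq) (Kbar Fq) ξ - α) ∧ vC Fq s2 = vC Fq s ∧
      (GT Fq ξ P).roots = s ::ₘ s2 ::ₘ M ∧ M.card + 2 = P.natDegree := by
  set s := α - algebraMap (K Fq) (Kbar Fq) ξ with hs
  have h0 : aeval s (FT Fq ξ P) = 0 := by
    rw [← eval_map_algebraMap]
    have := GT_eval Fq ξ P s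
    rw [GT] at this
    rw [this, hs, sub_add_cancel, hPα]
  obtain ⟨s2, M, h1, h2⟩ := two_roots (vC Fq) (vC_minpoly Fq) (FT Fq ξ P) (FT_ne_zero Fq ξ P hP) s h0
    (by
      intro x hx
      apply hα (x + ξ)
      rw [map_add, hx, hs, sub_add_cancel])
  refine ⟨s, s2, M, ?_, h1, h2, ?_⟩
  · rw [← vC_eq, hs, AbsoluteValue.map_sub]
  · have h3 := splits_iff_card_roots.mp (IsAlgClosed.splits (GT Fq ξ P))
    rw [GT_natDegree] at h3
    have h4 : (GT Fq ξ P).roots = s ::ₘ s2 ::ₘ M := h2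
    rw [h4] at h3
    simpa using h3

theorem step2a (Fq : Type) [Field Fq] [Fintype Fq] (ξ : K Fq) (n : ℕ) (w : ℝ) (hw1 : -1 ≤ w)
    (T : Set (Kbar Fq)) (hT : T.Infinite)
    (hTs : ∀ α ∈ T, (IsAlgKbar Fq α ∧ degAbar Fq α ≤ n ∧
      0 < absC Fq (algebraMap (K Fq) (Kbar Fq) ξ - α) ∧
      absC Fq (algebraMap (K Fq) (Kbar Fq) ξ - α) < HAbar Fq α ^ (-w - 1)) ∧
      ∀ x : K Fq, algebraMap (K Fq) (Kbar Fq) x ≠ α)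
    (S : Polynomial (Polynomial Fq)) (hS : Irreducible S) (hSd : 0 < S.natDegree)
    (hSξ : evalK Fq S ξ = 0) : 2 * (w + 1) ≤ S.natDegree := by
  by_contra hcon
  rw [not_le] at hcon
  set d := S.natDegree with hd
  set C1 : ℝ := (max 1 (absK Fq ξ)) ^ n with hC1
  have hC11 : 1 ≤ C1 := one_le_pow₀ (le_max_left _ _)
  set gS := (GT Fq ξ S).gaussNorm (vC Fq) 1 with hgS
  have hgS0 : 0 ≤ gS := Polynomial.gaussNorm_nonneg _ _ zero_le_one
  obtain ⟨B1, hB1⟩ := large_rpow (2 * (w + 1) - d) (by linarith) (C1 ^ d * gS ^ n)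
  obtain ⟨α, hαT, hαB⟩ := exists_large Fq n (max 1 (max B1 (HP Fq S))) T hT
    (fun x hx => ⟨(hTs x hx).1.1, (hTs x hx).1.2.1⟩)
  obtain ⟨⟨hα1, hα2, hα3, hα4⟩, hα5⟩ := hTs α hαT
  obtain ⟨P, hP, hPd, hPα, hPdeg, hPH⟩ := alg_data Fq α hα1
  obtain ⟨s, s2, M, hs, hs2, hroots, hM⟩ := outside_data Fq ξ α hα5 P hP.ne_zero hPα
  rw [hPH] at hαB hα4
  rw [hPdeg] at hα2
  rw [← hs] at hα3 hα4
  set H := HP Fq P with hH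
  have hH1 : 1 < H := (le_max_left _ _).trans_lt hαB
  have hH0 : 0 < H := by linarith
  have hb1 := hB1 H (((le_max_left _ _).trans (le_max_right _ _)).trans_lt hαB)
  have hb2 : HP Fq S < H := ((le_max_right _ _).trans (le_max_right _ _)).trans_lt hαB
  have hδ1 : vC Fq s ≤ 1 := hα4.le.trans
    (Real.rpow_le_one_of_one_le_of_nonpos hH1.le (by linarith))
  have gP1 : (GT Fq ξ P).gaussNorm (vC Fq) 1 ≤ C1 * H := GT_gauss Fq ξ n P hP.ne_zero hα2
  have hg2 := gauss_two (vC Fq) (vC_na Fq) (GT Fq ξ P) s s2 M hroots (vC Fq s) hα3 hδ1 le_rfl hs2.le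
  have hev : vC Fq ((GT Fq ξ P).eval 0) ≤ C1 * H * vC Fq s ^ 2 := by
    refine (eval_le_gauss (vC Fq) (vC_na Fq) (GT Fq ξ P) (vC Fq s) hα3.le 0
      (by rw [map_zero]; exact hα3.le)).trans (hg2.trans ?_)
    gcongr
  have h0mem : (0 : Kbar Fq) ∈ (GT Fq ξ S).roots := by
    rw [mem_roots (GT_ne_zero Fq ξ S hS.ne_zero), IsRoot.def, GT_eval, zero_add, evalKbar_alg_zero]
    exact hSξ
  obtain ⟨MS, hMS⟩ := Multiset.exists_cons_of_mem h0mem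
  have hMSc : MS.card + 1 = d := by
    have h3 := splits_iff_card_roots.mp (IsAlgClosed.splits (GT Fq ξ S))
    rw [GT_natDegree, hMS] at h3
    simpa using h3
  have hlow := res_lower Fq ξ S P hS.ne_zero n hα2 (by
    intro x hx hx'
    have h1 := min_dvd Fq S P hS hSd x hx hx'
    have h2 := hP.dvd_symm hS |>.mt
    have h3 : P ∣ S := hS.dvd_symm hP h1
    have := HP_dvd Fq P S hS.ne_zero h3
    linarith)
  have hup := res_one (vC Fq) (vC_na Fq) (GT Fq ξ S) (GT Fq ξ P) n (by rw [GT_natDegree]; exact hα2)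
    0 MS hMS (by rw [map_zero]; exact zero_le_one)
  have h1 := hlow.trans hup
  rw [← hgS] at h1
  have hnn := Polynomial.gaussNorm_nonneg (vC Fq) (GT Fq ξ P) zero_le_one
  have h2 : vC Fq ((GT Fq ξ P).eval 0) * (GT Fq ξ P).gaussNorm (vC Fq) 1 ^ MS.card * gS ^ n ≤
      (C1 * H * vC Fq s ^ 2) * (C1 * H) ^ MS.card * gS ^ n := by
    gcongr
  have h3 : (C1 * H * vC Fq s ^ 2) * (C1 * H) ^ MS.card * gS ^ n =
      (C1 ^ d * gS ^ n) * (H ^ d * vC Fq s ^ 2) := by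
    rw [← hMSc]; ring
  have h4 : H ^ d * vC Fq s ^ 2 ≤ H ^ ((d : ℝ) - 2 * (w + 1)) := by
    have : H ^ ((d : ℝ) - 2 * (w + 1)) = H ^ d * (H ^ (-w - 1)) ^ 2 := by
      rw [← Real.rpow_natCast, ← Real.rpow_natCast, ← Real.rpow_mul hH0.le, ← Real.rpow_add hH0]
      congr 1; push_cast; ring
    rw [this]
    gcongr
  have h5 : (1 : ℝ) ≤ (C1 ^ d * gS ^ n) * H ^ ((d : ℝ) - 2 * (w + 1)) := by
    refine (h1.trans (h2.trans h3.le)).trans ?_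
    gcongr
  have h6 : (d : ℝ) - 2 * (w + 1) = -(2 * (w + 1) - d) := by ring
  rw [h6, Real.rpow_neg hH0.le, ← div_eq_mul_inv, le_div_iff₀ (Real.rpow_pos_of_pos hH0 _)] at h5
  linarith

set_option maxHeartbeats 800000 in
theorem step2b (Fq : Type) [Field Fq] [Fintype Fq] (ξ : K Fq) (n : ℕ) (hn : 1 ≤ n) (w : ℝ)
    (hw : (n : ℝ) + 1 ≤ 2 * (w + 1))
    (T : Set (Kbar Fq)) (hT : T.Infinite)
    (hTs : ∀ α ∈ T, (IsAlgKbar Fq α ∧ degAbar Fq α ≤ n ∧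
      0 < absC Fq (algebraMap (K Fq) (Kbar Fq) ξ - α) ∧
      absC Fq (algebraMap (K Fq) (Kbar Fq) ξ - α) < HAbar Fq α ^ (-w - 1)) ∧
      ∀ x : K Fq, algebraMap (K Fq) (Kbar Fq) x ≠ α)
    (hξ : ∀ P : Polynomial (Polynomial Fq), P ≠ 0 → P.natDegree ≤ n → evalK Fq P ξ ≠ 0) :
    w ∈ wnstarSet Fq ξ n := by
  by_contra hcon
  have hn1 : (1 : ℝ) ≤ n := by exact_mod_cast hn
  obtain ⟨ρ, hρ, hnr⟩ := no_root Fq ξ n w hcon (by linarith)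
  obtain ⟨C2, hC2, hdir⟩ := dir2 Fq ξ n
  set C1 : ℝ := (max 1 (absK Fq ξ)) ^ n with hC1
  have hC11 : 1 ≤ C1 := one_le_pow₀ (le_max_left _ _)
  set A0 : ℝ := C1 * C2 with hA0
  have hA1 : C1 ≤ A0 := by nlinarith
  have hA2 : C2 ≤ A0 := by nlinarith
  have hA01 : 1 ≤ A0 := hC11.trans hA1
  have hM0 : 0 < w + 1 := by linarith
  obtain ⟨B1, hB1⟩ := large_rpow (w + 1) hM0 (1 / ρ)
  obtain ⟨α, hαT, hαB⟩ := exists_large Fq n (max 1 (max B1 (A0 ^ (2 * n)))) T hT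
    (fun x hx => ⟨(hTs x hx).1.1, (hTs x hx).1.2.1⟩)
  obtain ⟨⟨hα1, hα2, hα3, hα4⟩, hα5⟩ := hTs α hαT
  obtain ⟨P, hP, hPd, hPα, hPdeg, hPH⟩ := alg_data Fq α hα1
  obtain ⟨s, s2, M, hs, hs2, hroots, hM⟩ := outside_data Fq ξ α hα5 P hP.ne_zero hPα
  rw [hPH] at hαB hα4
  rw [hPdeg] at hα2
  rw [← hs] at hα3 hα4
  have hH1 : 1 < HP Fq P := (le_max_left _ _).trans_lt hαB
  obtain ⟨Q, hQ, hQm, hQH, hQξ⟩ := hdir P hH1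
  set H := HP Fq P with hH
  have hH0 : 0 < H := by linarith
  have hb1 := hB1 H (((le_max_left _ _).trans (le_max_right _ _)).trans_lt hαB)
  have hb2 : A0 ^ (2 * n) < H := ((le_max_right _ _).trans (le_max_right _ _)).trans_lt hαB
  set r : ℝ := H ^ (-w - 1) with hr
  have hr0 : 0 < r := Real.rpow_pos_of_pos hH0 _
  have hr1 : r ≤ 1 := Real.rpow_le_one_of_one_le_of_nonpos hH1.le (by linarith)
  have hrρ : r ≤ ρ := by
    have e : -w - 1 = -(w + 1) := by ring
    rw [hr, e, Real.rpow_neg hH0.le]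
    rw [div_lt_iff₀ hρ] at hb1
    rw [inv_le_iff_one_le_mul₀ (Real.rpow_pos_of_pos hH0 _)]
    linarith
  have gP1 : (GT Fq ξ P).gaussNorm (vC Fq) 1 ≤ A0 * H :=
    (GT_gauss Fq ξ n P hP.ne_zero hα2).trans (by gcongr)
  have gQ1' : (GT Fq ξ Q).gaussNorm (vC Fq) 1 ≤ A0 * H :=
    (GT_gauss Fq ξ n Q hQ hQm).trans (by
      have hQ0 := zero_le_one.trans (HP_ge_one Fq Q)
      rw [← hC1]
      exact mul_le_mul hA1 hQH.le hQ0 (by linarith))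
  have gQr : (GT Fq ξ Q).gaussNorm (vC Fq) r ≤ A0 / H ^ n := by
    refine (lemmaA (vC Fq) (vC_na Fq) (vC_minpoly Fq) (FT Fq ξ Q) (FT_ne_zero Fq ξ Q hQ) r hr0
      hr1 (hnr Q hQ hQm (hξ Q hQ hQm) H hQH.le r hrρ le_rfl)).trans ?_
    apply max_le
    · rw [vC_alg, FT_coeff_zero]
      rw [le_div_iff₀ (by positivity)]
      exact hQξ.trans hA2
    · calc _ ≤ (A0 * H) * r ^ 2 := mul_le_mul_of_nonneg_right gQ1' (by positivity)
        _ = A0 * (H * r ^ 2) := by ring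
        _ ≤ A0 * H ^ (-(n : ℝ)) := by
            have : H * r ^ 2 = H ^ (1 + (-w - 1) * 2) := by
              rw [hr, Real.rpow_add hH0, Real.rpow_one, Real.rpow_mul hH0.le, Real.rpow_two]
            rw [this]
            apply mul_le_mul_of_nonneg_left _ (by linarith)
            exact Real.rpow_le_rpow_of_exponent_le hH1.le (by linarith)
        _ = A0 / H ^ n := by rw [Real.rpow_neg hH0.le, Real.rpow_natCast, div_eq_mul_inv]
  have hlow := res_lower Fq ξ P Q hP.ne_zero n hQm (by
    intro x hx hx'
    have := HP_dvd Fq P Q hQ (min_dvd Fq P Q hP hPd x hx hx')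
    linarith)
  have hup := res_two (vC Fq) (vC_na Fq) (GT Fq ξ P) (GT Fq ξ Q) n (by rw [GT_natDegree]; exact hQm)
    s s2 M hroots r hr1 hα4.le (hs2.le.trans hα4.le)
  have h1 := hlow.trans hup
  have n1 := Polynomial.gaussNorm_nonneg (vC Fq) (GT Fq ξ P) zero_le_one
  have n2 := Polynomial.gaussNorm_nonneg (vC Fq) (GT Fq ξ Q) zero_le_one
  have n3 := Polynomial.gaussNorm_nonneg (vC Fq) (GT Fq ξ Q) hr0.le
  obtain ⟨k, hk⟩ : ∃ k, n = k + 2 := ⟨n - 2, by omega⟩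
  have hAH : 1 ≤ A0 * H := by nlinarith
  have h2 : (1 : ℝ) ≤ (A0 / H ^ n) ^ 2 * (A0 * H) ^ k * (A0 * H) ^ n := by
    calc (1 : ℝ) ≤ _ := h1
      _ ≤ (A0 / H ^ n) ^ 2 * (A0 * H) ^ M.card * (A0 * H) ^ n := by gcongr
      _ ≤ _ := by
        gcongr
        omega
  have h3 : (A0 / H ^ n) ^ 2 * (A0 * H) ^ k * (A0 * H) ^ n = A0 ^ (2 * n) / H ^ 2 := by
    exact final_id A0 H k n hk hH0
  rw [h3, le_div_iff₀ (by positivity)] at h2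
  nlinarith

theorem main_eq (Fq : Type) [Field Fq] [Fintype Fq] (ξ : K Fq) (n : ℕ) (hn : 1 ≤ n) :
    wnstar Fq ξ n = wnAt Fq ξ n := by
  apply le_antisymm (wnstar_le Fq ξ n)
  apply sSup_le
  rintro _ ⟨w, hw, rfl⟩
  show (w : EReal) ≤ _
  -- general lower bound
  have hhalf : ((-(1 / 2) : ℝ) : EReal) ≤ wnstar Fq ξ n := by
    by_cases h : ∀ P : Polynomial (Polynomial Fq), P ≠ 0 → P.natDegree ≤ 1 → evalK Fq P ξ ≠ 0
    · refine le_trans ?_ (lemmaW Fq ξ n 1 le_rfl hn h)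
      rw [EReal.coe_le_coe_iff]; norm_num
    · push Not at h
      obtain ⟨P, h1, h2, h3⟩ := h
      exact step0 Fq ξ n hn P h1 h2 h3
  by_cases hwh : w ≤ -(1 / 2)
  · exact (EReal.coe_le_coe_iff.mpr hwh).trans hhalf
  rw [not_le] at hwh
  set U := {α : Kbar Fq | IsAlgKbar Fq α ∧ degAbar Fq α ≤ n ∧
      0 < absC Fq (algebraMap (K Fq) (Kbar Fq) ξ - α) ∧
      absC Fq (algebraMap (K Fq) (Kbar Fq) ξ - α) < HAbar Fq α ^ (-w - 1)} with hU
  have hUinf : U.Infinite := hw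
  by_cases hin : (U ∩ Set.range (algebraMap (K Fq) (Kbar Fq))).Infinite
  · apply le_wnstar
    have hpre : (algebraMap (K Fq) (Kbar Fq) ⁻¹' U).Infinite := by
      intro hfin
      apply hin
      rw [← Set.image_preimage_eq_inter_range]
      exact hfin.image _
    refine Set.Infinite.mono ?_ hpre
    rintro α ⟨h1, h2, h3, h4⟩
    have e : absC Fq (algebraMap (K Fq) (Kbar Fq) ξ - algebraMap (K Fq) (Kbar Fq) α) =
        absK Fq (ξ - α) := by
      rw [← map_sub, ← vC_eq, vC_alg]
    rw [e] at h3 h4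
    rw [HAbar_alg] at h4
    rw [degAbar_alg] at h2
    exact ⟨(isAlg_alg Fq α).mp h1, h2, h3, h4⟩
  set T := U \ Set.range (algebraMap (K Fq) (Kbar Fq)) with hT
  have hTinf : T.Infinite := by
    intro hfin
    apply hUinf
    rw [← Set.inter_union_sdiff U (Set.range (algebraMap (K Fq) (Kbar Fq)))]
    exact (Set.not_infinite.mp hin).union hfin
  have hTs : ∀ α ∈ T, (IsAlgKbar Fq α ∧ degAbar Fq α ≤ n ∧
      0 < absC Fq (algebraMap (K Fq) (Kbar Fq) ξ - α) ∧
      absC Fq (algebraMap (K Fq) (Kbar Fq) ξ - α) < HAbar Fq α ^ (-w - 1)) ∧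
      ∀ x : K Fq, algebraMap (K Fq) (Kbar Fq) x ≠ α := by
    rintro α ⟨h1, h2⟩
    exact ⟨h1, fun x hx => h2 ⟨x, hx⟩⟩
  by_cases hξ : ∀ P : Polynomial (Polynomial Fq), P ≠ 0 → P.natDegree ≤ n → evalK Fq P ξ ≠ 0
  · by_cases h2 : (n : ℝ) + 1 ≤ 2 * (w + 1)
    · exact le_wnstar Fq ξ n w (step2b Fq ξ n hn w h2 T hTinf hTs hξ)
    · rw [not_le] at h2
      refine le_trans ?_ (lemmaW Fq ξ n n hn le_rfl hξ)
      rw [EReal.coe_le_coe_iff]; linarith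
  · push Not at hξ
    obtain ⟨R, hR, hRd, hRξ⟩ := hξ
    have hRb := (evalKbar_alg_zero Fq R ξ).mpr hRξ
    obtain ⟨S, hS, hSd, hSb, _, _⟩ := alg_data Fq _ ⟨R, hR, hRb⟩
    have hSξ := (evalKbar_alg_zero Fq S ξ).mp hSb
    have hSn : S.natDegree ≤ n :=
      (natDegree_le_of_dvd (min_dvd Fq S R hS hSd _ hSb hRb) hR).trans hRd
    have h2 := step2a Fq ξ n w (by linarith) T hTinf hTs S hS hSd hSξ
    by_cases hS1 : S.natDegree = 1
    · rw [hS1] at h2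
      push_cast at h2
      linarith
    · refine le_trans ?_ (lemmaW Fq ξ n (S.natDegree - 1) (by omega) (by omega) ?_)
      · rw [EReal.coe_le_coe_iff, Nat.cast_sub (by omega)]
        push_cast
        linarith
      · intro P hP hPd hPξ
        have := natDegree_le_of_dvd
          (min_dvd Fq S P hS hSd _ hSb ((evalKbar_alg_zero Fq P ξ).mpr hPξ)) hP
        omega

end final2

/-- `w_n^*(ξ) = w_n^@(ξ)`. -/
theorem wnstar_eq_wnAt (Fq : Type) [Field Fq] [Fintype Fq]
    (ξ : K Fq) (n : ℕ) (hn : 1 ≤ n) :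
    wnstar Fq ξ n = wnAt Fq ξ n := by
  exact main_eq Fq ξ n hn

end
end MahlerKoksmaFq
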